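/- arXiv:2312.10030 — 2 statements merged into one kernel-verified Lean document; each statement's English description precedes it below -/
import Mathlib

section
/- Lemma 2.1 (random walk avoiding a good obstacle): There exists a constant C₀ ∈ (0,∞) such that for all κ, L ≥ 1, R ≥ L, integers n ≥ 1, every x ∈ B(0, R + C₀L)^c, and every (L,R,n,κ)-good obstacle set 𝒪 ⊂ G, one has P₀(H_x < H_𝒪) ≤ C d(x, B(0, R + C₀L))^{−ν} · exp{−c κ n / L^ν}, where P₀ is the law of the random walk started at 0 and H_A is the entrance time of A. -/
open MeasureTheory ProbabilityTheory Real Filter Topology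
open scoped ENNReal NNReal BigOperators Classical

noncomputable section

/-! ## Generic exponents and corrections -/

/-- The exponent `b₁`: equal to `1` if `ν = 1` and `0` otherwise. -/
def bOne (ν : ℝ) : ℝ := if ν = 1 then 1 else 0

/-- The exponent `b₂`: equal to `1` if `α = 2ν` and `0` otherwise. -/
def bTwo (ν α : ℝ) : ℝ := if α = 2 * ν then 1 else 0

/-- The polylogarithmic correction `q(r)` from Theorem 1.1. -/
def qArm (ν α r : ℝ) : ℝ :=
  if ν = 1 then Real.log (Real.log r)
  else if ν < α / 2 then Real.log r ^ ((ν - 1) / 2) * Real.log (Real.log r) ^ ν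
  else Real.log r ^ ν * Real.log (Real.log r) ^ ν

/-- `exp(-t)` for an extended nonnegative real `t`. -/
def expNegE (t : ℝ≥0∞) : ℝ≥0∞ := if t = ⊤ then 0 else ENNReal.ofReal (Real.exp (-t.toReal))

/-! ## Transient weighted graphs

A weighted graph `𝒢 = (G, λ)`, connected and locally finite, with controlled weights,
equipped with a metric `d`, a distinguished base point `o`, and exponents `α` (volume
growth) and `ν` (Green's function decay). -/

structure WGraph where
  (V : Type) (countableV : Countable V) (o : V)
  (lam : V → V → ℝ)
  (lam_nonneg : ∀ x y, 0 ≤ lam x y)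
  (lam_symm : ∀ x y, lam x y = lam y x)
  (locFin : ∀ x, (Function.support (lam x)).Finite)
  (connectedG : ∀ x y, Relation.ReflTransGen (fun u v => 0 < lam u v) x y)
  -- controlled weights: `λ_{x,y}/λ_x ≥ c₀` for all neighbours `x ∼ y`
  (ctrl : ∃ c₀ > (0:ℝ), ∀ x y, 0 < lam x y → c₀ * (∑ᶠ z, lam x z) ≤ lam x y)
  (d : V → V → ℝ)
  (d_symm : ∀ x y, d x y = d y x)
  (d_self : ∀ x, d x x = 0)
  (d_pos : ∀ x y, x ≠ y → 0 < d x y)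
  (d_triangle : ∀ x y z, d x z ≤ d x y + d y z)
  (α : ℝ) (ν : ℝ)

namespace WGraph

variable (M : WGraph)

/-- Total weight `λ_x = Σ_{y} λ_{x,y}` at a vertex. -/
def lamTot (x : M.V) : ℝ := ∑ᶠ y, M.lam x y

/-- The (closed) ball `B(x,r)` for the metric `d`. -/
def ball (x : M.V) (r : ℝ) : Set M.V := {y | M.d x y ≤ r}

/-- One-step transition probability of the random walk on `(G,λ)`. -/
def p (x y : M.V) : ℝ := M.lam x y / M.lamTot x

/-- `n`-step transition probability of the random walk. -/
def pstep : ℕ → M.V → M.V → ℝ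
  | 0, x, y => if x = y then 1 else 0
  | n + 1, x, y => ∑ᶠ z, M.p x z * pstep n z y

/-- The Green's function `g(x,y) = λ_y^{-1} Σ_{n ≥ 0} P_x[Z_n = y]` of the walk. -/
def green (x y : M.V) : ℝ := (∑' n, M.pstep n x y) / M.lamTot y

/-- Transience of the random walk on `𝒢`. -/
def Transient : Prop := ∀ x, Summable fun n => M.pstep n x x

/-- The volume growth condition `(V_α)`. -/
def VolGrowth : Prop :=
  ∃ c > (0:ℝ), ∃ C > (0:ℝ), ∀ (x : M.V) (r : ℝ), 1 ≤ r →
    c * r ^ M.α ≤ (∑ᶠ y ∈ M.ball x r, M.lamTot y) ∧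
      (∑ᶠ y ∈ M.ball x r, M.lamTot y) ≤ C * r ^ M.α

/-- The Green's function decay condition `(G_ν)`. -/
def GreenDecay : Prop :=
  ∃ c > (0:ℝ), ∃ C > (0:ℝ),
    (∀ x : M.V, c ≤ M.green x x ∧ M.green x x ≤ C) ∧
    ∀ x y : M.V, x ≠ y →
      c * M.d x y ^ (-M.ν) ≤ M.green x y ∧ M.green x y ≤ C * M.d x y ^ (-M.ν)

/-- The standing assumptions on the graph: transience, `(V_α)` and `(G_ν)`. -/
def Standing : Prop := M.Transient ∧ M.VolGrowth ∧ M.GreenDecay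

/-- The graph distance `d_gr` on `𝒢`. -/
def graphDist (x y : M.V) : ℝ :=
  sInf {r : ℝ | ∃ n : ℕ, r = n ∧ ∃ γ : Fin (n + 1) → M.V, γ 0 = x ∧ γ (Fin.last n) = y ∧
    ∀ i : Fin n, 0 < M.lam (γ i.castSucc) (γ i.succ)}

/-- Capacity of a finite set of vertices, via the variational characterization
`cap(K) = (inf_μ Σ_{x,y} μ(x) g(x,y) μ(y))⁻¹`, the infimum being over probability
measures supported on `K`. -/
def capFinset (K : Finset M.V) : ℝ :=
  (sInf {E : ℝ | ∃ μ : M.V → ℝ, (∀ x, 0 ≤ μ x) ∧ (∀ x, x ∉ K → μ x = 0) ∧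
    (∑ x ∈ K, μ x) = 1 ∧ E = ∑ x ∈ K, ∑ y ∈ K, μ x * M.green x y * μ y})⁻¹

/-- Capacity of an arbitrary set of vertices. -/
def cap (S : Set M.V) : ℝ := ⨆ K : {K : Finset M.V // ↑K ⊆ S}, M.capFinset K.1

/-- Weight `∏_{i<n} p(x_i, x_{i+1})` of a finite random walk trajectory. -/
def pathWt {n : ℕ} (γ : Fin (n + 1) → M.V) : ℝ := ∏ i : Fin n, M.p (γ i.castSucc) (γ i.succ)

/-- `P_z[H_x < H_O]`: the probability that the random walk started at `z` hits `x`
strictly before hitting the set `O`, expressed through a first-passage path decomposition. -/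
def hitBefore (z x : M.V) (O : Set M.V) : ℝ :=
  ∑' n : ℕ, ∑' γ : Fin (n + 1) → M.V,
    if γ 0 = z ∧ γ (Fin.last n) = x ∧ x ∉ O ∧
        (∀ i : Fin (n + 1), i ≠ Fin.last n → γ i ∉ O ∧ γ i ≠ x)
      then M.pathWt γ else 0

/-- Distance from a point to a set. -/
def dSet (x : M.V) (S : Set M.V) : ℝ := sInf (M.d x '' S)

/-! ### Discrete (rooted) loops

A rooted discrete loop visiting `m + 2` vertices (`m ≥ 0`), i.e. making at least two
jumps, encoded by its skeleton `Z_0, …, Z_{n-1}` (with `Z_n = Z_0`, indices mod `n`). -/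

/-- The type of rooted discrete loops on `G` making `n = m + 2 ≥ 2` jumps. -/
abbrev DLoop : Type := Σ m : ℕ, Fin (m + 2) → M.V

/-- The mass `(1/n) ∏_{0 ≤ i < n} λ_{x_i,x_{i+1}}/λ_{x_i}` that the loop measure `μ`
assigns to a given rooted discrete loop (its discrete skeleton intensity). -/
def dloopWt (γ : M.DLoop) : ℝ≥0∞ :=
  ENNReal.ofReal ((1 / ((γ.1 : ℝ) + 2)) * ∏ i : Fin (γ.1 + 2), M.p (γ.2 i) (γ.2 (i + 1)))

/-- The set of vertices visited by a discrete loop (`range(γ) ∩ G` for the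
corresponding continuous loop). -/
def dloopRange (γ : M.DLoop) : Set M.V := Set.range γ.2

/-- The loop measure `μ` evaluated on a set of (skeletons of) loops: since the events of
interest only depend on the vertices visited by a loop, the measure under `μ` of such an
event coincides with the total mass of the corresponding discrete skeletons. -/
def loopMeas (S : Set M.DLoop) : ℝ≥0∞ := ∑' γ : S, M.dloopWt γ

end WGraph

/-! ## Graphs equipped with an approximate renormalized lattice `Λ(L)` -/

structure LGraph extends WGraph where
  (Lat : ℝ → Set V)
  (Lat_base : ∀ L : ℝ, 1 ≤ L → o ∈ Lat L)
  (Lat_cover : ∀ L : ℝ, 1 ≤ L → ∀ x, ∃ y ∈ Lat L, d y x ≤ L)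
  (Lat_disj : ∀ L : ℝ, 1 ≤ L → ∀ y ∈ Lat L, ∀ z ∈ Lat L, y ≠ z →
    ∀ w, d y w ≤ L / 2 → ¬ d z w ≤ L / 2)
  (Lat_card : ∃ CΛ > (0:ℝ), ∀ L : ℝ, 1 ≤ L → ∀ (x : V) (N : ℕ), 1 ≤ N →
    {y | y ∈ Lat L ∧ d x y ≤ L * N}.Finite ∧
      ({y | y ∈ Lat L ∧ d x y ≤ L * N}.ncard : ℝ) ≤ CΛ * (N : ℝ) ^ α)

namespace LGraph

variable (M : LGraph)

/-- A path `π = (x_i)_{1 ≤ i ≤ M}` in `Λ(L)` from the base point `0` to `A ⊆ G`. -/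
def IsLatPath (L : ℝ) (A : Set M.V) {m : ℕ} (pa : Fin (m + 1) → M.V) : Prop :=
  pa 0 = M.o ∧ pa (Fin.last m) ∈ A ∧ (∀ i, pa i ∈ M.Lat L) ∧
    ∀ i : Fin m, ∃ x y, M.d (pa i.castSucc) x ≤ L ∧ M.d (pa i.succ) y ≤ L ∧ 0 < M.lam x y

/-- `𝒪 ⊆ G` is an `(L,R,n,κ)`-good obstacle: every path in `Λ(L)` from `0` to `B_R^c`
contains at least `n` points `y` (within `B_R`) with `cap(𝒪 ∩ B(y,L)) ≥ κ`. -/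
def GoodObstacle (O : Set M.V) (L R : ℝ) (n : ℝ) (κ : ℝ) : Prop :=
  ∀ (m : ℕ) (pa : Fin (m + 1) → M.V), M.IsLatPath L {y | R < M.d M.o y} pa →
    ∃ A : Finset M.V, (∀ y ∈ A, (∃ i, pa i = y) ∧ M.d M.o y ≤ R) ∧ n ≤ (A.card : ℝ) ∧
      ∀ y ∈ A, κ ≤ M.toWGraph.cap (O ∩ {z | M.d y z ≤ L})

/-- The layer `𝒜_k ⊆ Λ(L)` of lattice points whose `L`-ball meets the interior
boundary `∂B(0, C₁ k L)`. -/
def layer (C₁ L : ℝ) (k : ℕ) : Set M.V :=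
  {x | x ∈ M.Lat L ∧ ∃ y, M.d x y ≤ L ∧ M.d M.o y ≤ C₁ * k * L ∧
    ∃ z, 0 < M.lam y z ∧ C₁ * k * L < M.d M.o z}

/-- The annulus `𝔸_k = ∪_{x ∈ 𝒜_k} B(x,L)`. -/
def annulus (C₁ L : ℝ) (k : ℕ) : Set M.V := {v | ∃ x ∈ M.layer C₁ L k, M.d x v ≤ L}

end LGraph

/-! ## The Gaussian free field and its associated bond percolation `E^{≥a}` -/

/-- A transient weighted graph together with a Gaussian free field `φ` (law `ℙ`) and,
conditionally on `φ`, independent bond percolation configurations: each edge `{x,y}` is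
retained in `E^{≥a}` (i.e. `opn a`) independently with probability
`1 - exp(-2 λ_{x,y} (φ_x - a)_+ (φ_y - a)_+)`. -/
structure Model extends WGraph where
  (Ω : Type) [mΩ : MeasurableSpace Ω] (P : Measure Ω) (Pprob : IsProbabilityMeasure P)
  (φ : Ω → V → ℝ)
  (φ_meas : ∀ x, Measurable fun ω => φ ω x)
  -- `φ` is the centered Gaussian field with covariance the Green's function `g`
  (φ_gauss : ∀ (s : Finset V) (c : V → ℝ),
    Measure.map (fun ω => ∑ x ∈ s, c x * φ ω x) P =
      gaussianReal 0 (Real.toNNReal (∑ x ∈ s, ∑ y ∈ s, c x * c y * toWGraph.green x y)))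
  (opn : ℝ → Ω → V → V → Prop)
  (opn_symm : ∀ a ω x y, opn a ω x y → opn a ω y x)
  (opn_edge : ∀ a ω x y, opn a ω x y → 0 < lam x y)
  (opn_meas : ∀ a x y, MeasurableSet {ω | opn a ω x y})
  -- conditionally on `φ`, edges are open independently with the prescribed probabilities
  (opn_law : ∀ (a : ℝ) (s t : Finset (V × V)), Disjoint s t →
    (∀ e ∈ s ∪ t, ∀ f ∈ s ∪ t, e ≠ f → e ≠ Prod.swap f) →
    ∀ B : Set (V → ℝ), MeasurableSet B →
      P ({ω | φ ω ∈ B} ∩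
          {ω | (∀ e ∈ s, opn a ω e.1 e.2) ∧ (∀ e ∈ t, ¬ opn a ω e.1 e.2)}) =
      ∫⁻ ω in {ω | φ ω ∈ B},
        ENNReal.ofReal
          ((∏ e ∈ s,
            (1 - Real.exp (-(2 * lam e.1 e.2 * max (φ ω e.1 - a) 0 * max (φ ω e.2 - a) 0)))) *
           ∏ e ∈ t,
            Real.exp (-(2 * lam e.1 e.2 * max (φ ω e.1 - a) 0 * max (φ ω e.2 - a) 0))) ∂P)

attribute [instance] Model.mΩ

namespace Model

variable (M : Model)

/-- `x` and `y` are connected by a path of open edges of `E^{≥a}`. -/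
def conn (a : ℝ) (ω : M.Ω) (x y : M.V) : Prop :=
  Relation.ReflTransGen (fun u v => M.opn a ω u v) x y

/-- The open cluster `𝒦^a` of `x` in `E^{≥a}`. -/
def cluster (a : ℝ) (ω : M.Ω) (x : M.V) : Set M.V := {y | M.conn a ω x y}

/-- The probability of an event. -/
def prob (s : Set M.Ω) : ℝ := (M.P s).toReal

/-- The one-arm event `{x ↔ B(x,R)^c}` in `E^{≥0}`. -/
def armEvent (x : M.V) (R : ℝ) : Set M.Ω := {ω | ∃ y, R < M.d x y ∧ M.conn 0 ω x y}

/-- The truncated two-point function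
`τ_a^tr(x,y) = ℙ(x ↔ y in E^{≥a}, x ↮ ∞ in E^{≥a})`. -/
def tau (a : ℝ) (x y : M.V) : ℝ :=
  M.prob {ω | M.conn a ω x y ∧ (M.cluster a ω x).Finite}

/-- The truncated expected cluster volume `𝔼[|𝒦^a| 1_{|𝒦^a| < ∞}]`. -/
def clusterVol (a : ℝ) (x : M.V) : ℝ≥0∞ :=
  ∫⁻ ω, (if (M.cluster a ω x).Finite then ((M.cluster a ω x).ncard : ℝ≥0∞) else 0) ∂M.P

end Model

/-! ## The concrete case `G = ℤ³` with unit weights and the Euclidean distance -/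

/-- The vertex set `ℤ³`. -/
abbrev Z3 : Type := Fin 3 → ℤ

/-- Euclidean distance on `ℤ³`. -/
def dZ (x y : Z3) : ℝ := Real.sqrt (∑ i, ((x i : ℝ) - (y i : ℝ)) ^ 2)

/-- Unit weights: `λ_{x,y} = 1_{|x-y| = 1}`. -/
def lamZ (x y : Z3) : ℝ := if dZ x y = 1 then 1 else 0

/-- Transition probabilities of simple random walk on `ℤ³`. -/
def pZ (x y : Z3) : ℝ := lamZ x y / 6

/-- `n`-step transition probabilities of simple random walk on `ℤ³`. -/
def pstepZ : ℕ → Z3 → Z3 → ℝ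
  | 0, x, y => if x = y then 1 else 0
  | n + 1, x, y => ∑ᶠ z, pZ x z * pstepZ n z y

/-- The Green's function of simple random walk on `ℤ³` (with the normalization
`g(x,y) = λ_y^{-1} Σ_n P_x[Z_n = y]`, `λ_y = 6`). -/
def greenZ (x y : Z3) : ℝ := (∑' n, pstepZ n x y) / 6

/-- Euclidean distance between a point of `ℝ³` and a point of `ℤ³`. -/
def dMix (u : Fin 3 → ℝ) (z : Z3) : ℝ := Real.sqrt (∑ i, (u i - (z i : ℝ)) ^ 2)

/-- The Gaussian free field on `ℤ³` together with the associated bond percolation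
configurations `E^{≥a}`. -/
structure PercZ3 where
  (Ω : Type) [mΩ : MeasurableSpace Ω] (P : Measure Ω) (Pprob : IsProbabilityMeasure P)
  (φ : Ω → Z3 → ℝ)
  (φ_meas : ∀ x, Measurable fun ω => φ ω x)
  (φ_gauss : ∀ (s : Finset Z3) (c : Z3 → ℝ),
    Measure.map (fun ω => ∑ x ∈ s, c x * φ ω x) P =
      gaussianReal 0 (Real.toNNReal (∑ x ∈ s, ∑ y ∈ s, c x * c y * greenZ x y)))
  (opn : ℝ → Ω → Z3 → Z3 → Prop)
  (opn_symm : ∀ a ω x y, opn a ω x y → opn a ω y x)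
  (opn_edge : ∀ a ω x y, opn a ω x y → 0 < lamZ x y)
  (opn_meas : ∀ a x y, MeasurableSet {ω | opn a ω x y})
  (opn_law : ∀ (a : ℝ) (s t : Finset (Z3 × Z3)), Disjoint s t →
    (∀ e ∈ s ∪ t, ∀ f ∈ s ∪ t, e ≠ f → e ≠ Prod.swap f) →
    ∀ B : Set (Z3 → ℝ), MeasurableSet B →
      P ({ω | φ ω ∈ B} ∩
          {ω | (∀ e ∈ s, opn a ω e.1 e.2) ∧ (∀ e ∈ t, ¬ opn a ω e.1 e.2)}) =
      ∫⁻ ω in {ω | φ ω ∈ B},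
        ENNReal.ofReal
          ((∏ e ∈ s,
            (1 - Real.exp (-(2 * lamZ e.1 e.2 * max (φ ω e.1 - a) 0 * max (φ ω e.2 - a) 0)))) *
           ∏ e ∈ t,
            Real.exp (-(2 * lamZ e.1 e.2 * max (φ ω e.1 - a) 0 * max (φ ω e.2 - a) 0))) ∂P)

attribute [instance] PercZ3.mΩ

namespace PercZ3

variable (M : PercZ3)

/-- Connectivity by open edges in `E^{≥a}`. -/
def conn (a : ℝ) (ω : M.Ω) (x y : Z3) : Prop :=
  Relation.ReflTransGen (fun u v => M.opn a ω u v) x y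

/-- The open cluster of `x` in `E^{≥a}`. -/
def cluster (a : ℝ) (ω : M.Ω) (x : Z3) : Set Z3 := {y | M.conn a ω x y}

/-- The truncated two-point function on `ℤ³`. -/
def tau (a : ℝ) (x y : Z3) : ℝ :=
  ((M.P {ω | M.conn a ω x y ∧ (M.cluster a ω x).Finite}).toReal)

end PercZ3

/-! ## The metric graph (cable system) `𝔾̃`, killed Green's functions and killed GFFs -/

/-- The cable system `𝔾̃` over a graph `𝒢` (with renormalized lattice), together with the
killed Green's functions `g_U` and the laws `ℙ_U` of the Gaussian free field on open sets
`U ⊆ 𝔾̃` (the field killed outside `U`). -/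
structure CableG extends LGraph where
  (Gt : Type) [topGt : TopologicalSpace Gt] [msGt : MeasurableSpace Gt]
  (ι : V → Gt) (ι_inj : Function.Injective ι)
  (gU : Set Gt → Gt → Gt → ℝ)
  (gU_symm : ∀ U x y, gU U x y = gU U y x)
  (gU_zero : ∀ U x y, x ∉ U → gU U x y = 0)
  -- the Green's function of the full cable system restricts to `g` on `G`
  (gU_univ : ∀ x y : V, gU Set.univ (ι x) (ι y) = toWGraph.green x y)
  (PU : Set Gt → Measure (Gt → ℝ))
  (PU_prob : ∀ U, IsProbabilityMeasure (PU U))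
  -- `ℙ_U` is the law of the centered Gaussian field with covariance `g_U`
  (PU_gauss : ∀ (U : Set Gt) (s : Finset Gt) (c : Gt → ℝ),
    Measure.map (fun h => ∑ q ∈ s, c q * h q) (PU U) =
      gaussianReal 0 (Real.toNNReal (∑ q ∈ s, ∑ q' ∈ s, c q * c q' * gU U q q')))

attribute [instance] CableG.topGt CableG.msGt

/-- A probability space. -/
structure ProbSpace where
  (Ω : Type) [mΩ : MeasurableSpace Ω] (P : Measure Ω) (Pprob : IsProbabilityMeasure P)

attribute [instance] ProbSpace.mΩ

/-- A cable system as above, together with the laws of the vacant sets `Ṽ^u` of random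
interlacements at level `u > 0` on `𝔾̃`, axiomatized through their characterizing
properties: `Ṽ^u` is open and `ℙ(F ⊆ Ṽ^u) = exp(-u cap(F))` for finite `F ⊆ G`. -/
structure CableRI extends CableG where
  [msSetGt : MeasurableSpace (Set Gt)]
  (RIVacant : ℝ → Measure (Set Gt))
  (RIVacant_prob : ∀ u : ℝ, 0 < u → IsProbabilityMeasure (RIVacant u))
  (RIVacant_open : ∀ u : ℝ, 0 < u → ∀ᵐ S ∂(RIVacant u), @IsOpen Gt topGt S)
  (RIVacant_cap : ∀ u : ℝ, 0 < u → ∀ F : Finset V,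
    (RIVacant u {S | ∀ x ∈ F, ι x ∈ S}).toReal =
      Real.exp (-(u * toWGraph.capFinset F)))

attribute [instance] CableRI.msSetGt

/-! ## The Markovian loop soup at intensity `1/2` on the cable system -/

/-- The Poisson loop soup `ℒ` of intensity `(1/2)μ` on the cable system `𝔾̃` of a graph
`𝒢` (with renormalized lattice), under the law `Q`.  Continuous loops are axiomatized
through their ranges in `𝔾̃` and their discrete skeletons; the intensity measure `μ` is
pinned down via its (concrete) discrete skeleton intensity, and the law of the soup via
its void probabilities `Q(ℒ ∩ S = ∅) = exp(-μ(S)/2)`. -/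
structure LoopSoup extends LGraph where
  -- the cable system
  (Gt : Type) [topGt : TopologicalSpace Gt]
  (ι : V → Gt) (ι_inj : Function.Injective ι)
  (cable : V → V → Set Gt)
  (cable_symm : ∀ x y, cable x y = cable y x)
  (cable_ends : ∀ x y, 0 < lam x y → ι x ∈ cable x y ∧ ι y ∈ cable x y)
  (cable_vertices : ∀ x y, 0 < lam x y → ∀ v : V, ι v ∈ cable x y → v = x ∨ v = y)
  (cable_cover : ∀ q : Gt, (∃ v, q = ι v) ∨ ∃ x y, 0 < lam x y ∧ q ∈ cable x y)
  -- continuous loops on the cable system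
  (CLoop : Type) [msLoop : MeasurableSpace CLoop]
  (crange : CLoop → Set Gt)
  (traceG : CLoop → Set V)
  (trace_spec : ∀ γ, traceG γ = {v | ι v ∈ crange γ})
  -- the loop measure `μ` and its discrete skeleton
  (μC : Measure CLoop)
  (skel : CLoop → Option (Σ m : ℕ, Fin (m + 2) → V))
  (skel_spec : ∀ γ dγ, skel γ = some dγ → traceG γ = Set.range dγ.2)
  (skel_trivial : ∀ γ, skel γ = none → (traceG γ).Subsingleton)
  (μC_skel : ∀ S : Set (Σ m : ℕ, Fin (m + 2) → V),
    μC {γ | ∃ dγ ∈ S, skel γ = some dγ} = toWGraph.loopMeas S)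
  -- the loop soup and its law
  (Ωq : Type) [mΩq : MeasurableSpace Ωq] (Q : Measure Ωq) (Qprob : IsProbabilityMeasure Q)
  (soup : Ωq → Set CLoop)
  (soup_void : ∀ S : Set CLoop, MeasurableSet S →
    Q {ω | ∀ γ ∈ soup ω, γ ∉ S} = expNegE (μC S / 2))

attribute [instance] LoopSoup.topGt LoopSoup.msLoop LoopSoup.mΩq

namespace LoopSoup

variable (M : LoopSoup)

/-- Two loops of the soup are linked if they can be joined by a finite chain of loops of
the soup whose ranges successively intersect. -/
def linked (ω : M.Ωq) (γ γ' : M.CLoop) : Prop :=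
  Relation.ReflTransGen
    (fun g g' => g ∈ M.soup ω ∧ g' ∈ M.soup ω ∧ (M.crange g ∩ M.crange g').Nonempty) γ γ'

/-- The trace `𝒞` on `𝔾̃` of the cluster of loops of `ℒ` containing the base point `0`. -/
def C0 (ω : M.Ωq) : Set M.Gt :=
  {q | ∃ γ ∈ M.soup ω, q ∈ M.crange γ ∧
    ∃ γ₀ ∈ M.soup ω, M.ι M.o ∈ M.crange γ₀ ∧ M.linked ω γ γ₀}

/-- A loop is big (for the parameters `δ, L`) if `cap(range(γ) ∩ G) ≥ δ L^ν (log L)^{-b₂}`. -/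
def isBig (δ L : ℝ) (γ : M.CLoop) : Prop :=
  δ * L ^ M.ν * Real.log L ^ (-(bTwo M.ν M.α)) ≤ M.toWGraph.cap (M.traceG γ)

/-- The box `B̃(x,L) ⊆ 𝔾̃`: the ball `B(x,L)` together with all cables joining
neighbouring vertices of `B(x,L)`. -/
def Btilde (x : M.V) (L : ℝ) : Set M.Gt :=
  (M.ι '' {y | M.d x y ≤ L}) ∪
    ⋃ (u : M.V) (v : M.V) (_ : 0 < M.lam u v ∧ M.d x u ≤ L ∧ M.d x v ≤ L), M.cable u v

/-- A loop belongs to (the support of) `ℒ_k^b`: it is big and its range is contained in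
`B̃(x,L)` for some `x ∈ 𝒜_k`. -/
def inLayerBig (C₁ δ L : ℝ) (k : ℕ) (γ : M.CLoop) : Prop :=
  M.isBig δ L γ ∧ ∃ x ∈ M.toLGraph.layer C₁ L k, M.crange γ ⊆ M.Btilde x L

/-- The event `𝐁_k`: the cluster `𝒞` of `0` reaches `B_R^c` but contains no big loop of
`ℒ_k^b`. -/
def Bk (C₁ δ L R : ℝ) (k : ℕ) : Set M.Ωq :=
  {ω | (∃ y : M.V, R < M.d M.o y ∧ M.ι y ∈ M.C0 ω) ∧
    ∀ γ ∈ M.soup ω, M.inLayerBig C₁ δ L k γ → ¬ M.crange γ ⊆ M.C0 ω}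

/-- The number `N` of bad annuli among `k ∈ {1, …, ℓ}`. -/
def Nbad (C₁ δ L R : ℝ) (ℓ : ℕ) (ω : M.Ωq) : ℕ :=
  ((Finset.Icc 1 ℓ).filter fun k => ω ∈ M.Bk C₁ δ L R k).card

/-- The obstacle set `𝒪 = G ∩ 𝐼̃_D^b`: all vertices visited by a big loop of the soup
contained in a box `B̃(x,L)` with `x ∈ 𝒜_k` for some `k ∈ D`. -/
def obstacleD (C₁ δ L : ℝ) (D : Finset ℕ) (ω : M.Ωq) : Set M.V :=
  {v | ∃ γ ∈ M.soup ω, (∃ k ∈ D, M.inLayerBig C₁ δ L k γ) ∧ M.ι v ∈ M.crange γ}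

end LoopSoup

namespace WGraph

variable (M : WGraph)

/-! ## The one-step averaging operator -/

/-- The average of `f` under one step of the random walk from `x`. -/
def avg (f : M.V → ℝ) (x : M.V) : ℝ := ∑ y ∈ (M.locFin x).toFinset, M.p x y * f y

theorem mem_nbr {x y : M.V} : y ∈ (M.locFin x).toFinset ↔ 0 < M.lam x y := by
  simp [(M.lam_nonneg x y).lt_iff_ne, eq_comm]

theorem lamTot_nonneg (x : M.V) : 0 ≤ M.lamTot x := finsum_nonneg (M.lam_nonneg x)

theorem p_nonneg (x y : M.V) : 0 ≤ M.p x y :=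
  div_nonneg (M.lam_nonneg x y) (M.lamTot_nonneg x)

theorem sum_p {x : M.V} (hx : M.lamTot x ≠ 0) :
    ∑ y ∈ (M.locFin x).toFinset, M.p x y = 1 := by
  have h : M.lamTot x = ∑ y ∈ (M.locFin x).toFinset, M.lam x y := finsum_eq_sum _ (M.locFin x)
  simp only [p]
  rw [← Finset.sum_div, ← h, div_self hx]

theorem finsum_p_mul (f : M.V → ℝ) (x : M.V) : ∑ᶠ y, M.p x y * f y = M.avg f x := by
  refine finsum_eq_sum_of_support_subset _ fun y hy => ?_
  have : M.lam x y ≠ 0 := by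
    rintro h
    simp [p, h] at hy
  simpa using this

theorem avg_mono {f g : M.V → ℝ} (h : ∀ y, f y ≤ g y) (x : M.V) : M.avg f x ≤ M.avg g x :=
  Finset.sum_le_sum fun y _ => mul_le_mul_of_nonneg_left (h y) (M.p_nonneg x y)

theorem avg_nonneg {f : M.V → ℝ} (h : ∀ y, 0 ≤ f y) (x : M.V) : 0 ≤ M.avg f x :=
  Finset.sum_nonneg fun y _ => mul_nonneg (M.p_nonneg x y) (h y)

theorem avg_add (f g : M.V → ℝ) (x : M.V) :
    M.avg (fun y => f y + g y) x = M.avg f x + M.avg g x := by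
  simp [avg, mul_add, Finset.sum_add_distrib]

theorem avg_const_mul (a : ℝ) (f : M.V → ℝ) (x : M.V) :
    M.avg (fun y => a * f y) x = a * M.avg f x := by
  simp [avg, Finset.mul_sum, mul_left_comm]

theorem avg_mul_const (a : ℝ) (f : M.V → ℝ) (x : M.V) :
    M.avg (fun y => f y * a) x = M.avg f x * a := by
  simp [avg, Finset.sum_mul, mul_assoc]

theorem avg_finset_sum {ι : Type*} (s : Finset ι) (f : ι → M.V → ℝ) (x : M.V) :
    M.avg (fun y => ∑ i ∈ s, f i y) x = ∑ i ∈ s, M.avg (f i) x := by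
  simp only [avg, Finset.mul_sum]
  exact Finset.sum_comm

theorem avg_const {x : M.V} (hx : M.lamTot x ≠ 0) (a : ℝ) : M.avg (fun _ => a) x = a := by
  rw [avg, ← Finset.sum_mul, M.sum_p hx, one_mul]

theorem avg_tsum {f : ℕ → M.V → ℝ} (h : ∀ y, Summable fun n => f n y) (x : M.V) :
    M.avg (fun y => ∑' n, f n y) x = ∑' n, M.avg (f n) x := by
  simp only [avg, ← tsum_mul_left]
  exact (Summable.tsum_finsetSum fun y _ => (h y).mul_left _).symm

theorem summable_avg {f : ℕ → M.V → ℝ} (h : ∀ y, Summable fun n => f n y) (x : M.V) :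
    Summable fun n => M.avg (f n) x :=
  summable_sum fun y _ => (h y).mul_left _

/-- A form of the maximum principle on a finite proper subset `D`: at each point of `D` the
function `f` is either at most `b`, or it is subharmonic there and it is at most `b` at the
neighbours outside `D`. -/
theorem maximum_principle (hlam : ∀ x, M.lamTot x ≠ 0) {D : Set M.V} (hD : D.Finite)
    {a : M.V} (ha : a ∉ D) {f : M.V → ℝ} {b : ℝ}
    (h : ∀ w ∈ D, f w ≤ b ∨ (f w ≤ M.avg f w ∧ ∀ v, 0 < M.lam w v → v ∈ D ∨ f v ≤ b))
    {w : M.V} (hw : w ∈ D) : f w ≤ b := by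
  by_contra! hb
  obtain ⟨w₀, hw₀, hmax⟩ := Set.exists_max_image D f hD ⟨w, hw⟩
  have hb₀ : b < f w₀ := hb.trans_le (hmax w hw)
  have key : ∀ v, Relation.ReflTransGen (fun u v => 0 < M.lam u v) w₀ v →
      v ∈ D ∧ f v = f w₀ := by
    intro v hv
    induction hv with
    | refl => exact ⟨hw₀, rfl⟩
    | @tail u v _ huv ih =>
      obtain ⟨huD, hfu⟩ := ih
      rcases h u huD with h1 | ⟨h1, h2⟩
      · linarith
      have hle : ∀ v, 0 < M.lam u v → f v ≤ f w₀ := fun v hv =>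
        (h2 v hv).elim (hmax v) fun h => h.trans hb₀.le
      have hfv : f v = f w₀ := by
        by_contra hne
        have hlt : M.avg f u < M.avg (fun _ => f w₀) u := by
          refine Finset.sum_lt_sum (fun y hy => mul_le_mul_of_nonneg_left
            (hle y (M.mem_nbr.1 hy)) (M.p_nonneg u y)) ⟨v, M.mem_nbr.2 huv, ?_⟩
          exact mul_lt_mul_of_pos_left (lt_of_le_of_ne (hle v huv) hne)
            (div_pos huv ((M.lamTot_nonneg u).lt_of_ne' (hlam u)))
        rw [M.avg_const (hlam u)] at hlt
        linarith
      exact ⟨(h2 v huv).resolve_right (by linarith), hfv⟩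
  exact ha (key a (M.connectedG w₀ a)).1

/-! ## Green's function -/

/-- The two-sided bounds of condition `(G_ν)` with explicit constants. -/
def GreenBounds (c C : ℝ) : Prop :=
  (∀ x : M.V, c ≤ M.green x x ∧ M.green x x ≤ C) ∧
    ∀ x y : M.V, x ≠ y →
      c * M.d x y ^ (-M.ν) ≤ M.green x y ∧ M.green x y ≤ C * M.d x y ^ (-M.ν)

theorem pstep_succ (n : ℕ) (x y : M.V) :
    M.pstep (n + 1) x y = M.avg (fun z => M.pstep n z y) x := M.finsum_p_mul _ x

theorem p_reversible (hlam : ∀ x, M.lamTot x ≠ 0) (x y : M.V) :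
    M.lamTot x * M.p x y = M.lamTot y * M.p y x := by
  rw [p, p, mul_div_cancel₀ _ (hlam x), mul_div_cancel₀ _ (hlam y), M.lam_symm]

theorem p_eq_zero_of_notMem {x y : M.V} (h : y ∉ (M.locFin x).toFinset) : M.p x y = 0 := by
  have : M.lam x y = 0 := by simpa using h
  simp [p, this]

theorem pstep_succ_right (n : ℕ) (x y : M.V) :
    M.pstep (n + 1) x y = ∑ z ∈ (M.locFin y).toFinset, M.pstep n x z * M.p z y := by
  have hmem : ∀ x y, y ∈ (M.locFin x).toFinset ↔ x ∈ (M.locFin y).toFinset := fun x y => by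
    rw [mem_nbr, mem_nbr, M.lam_symm]
  induction n generalizing x with
  | zero =>
    rw [pstep_succ, avg]
    simp only [pstep, mul_ite, mul_one, mul_zero, ite_mul, one_mul, zero_mul,
      Finset.sum_ite_eq, Finset.sum_ite_eq', hmem x y]
  | succ n ih =>
    rw [pstep_succ]
    simp only [ih]
    rw [avg_finset_sum]
    refine Finset.sum_congr rfl fun z _ => ?_
    rw [avg_mul_const, ← pstep_succ]

theorem pstep_reversible (hlam : ∀ x, M.lamTot x ≠ 0) (n : ℕ) (x y : M.V) :
    M.lamTot x * M.pstep n x y = M.lamTot y * M.pstep n y x := by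
  induction n generalizing x with
  | zero =>
    by_cases h : x = y
    · simp [h]
    · simp [pstep, h, Ne.symm h]
  | succ n ih =>
    rw [pstep_succ, M.pstep_succ_right n, avg, Finset.mul_sum, Finset.mul_sum]
    refine Finset.sum_congr rfl fun z _ => ?_
    linear_combination M.pstep n z y * M.p_reversible hlam x z + M.p z x * ih z

theorem green_symm (hlam : ∀ x, M.lamTot x ≠ 0) (x y : M.V) : M.green x y = M.green y x := by
  rw [green, green, div_eq_div_iff (hlam y) (hlam x), ← tsum_mul_right, ← tsum_mul_right]
  refine tsum_congr fun n => ?_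
  linear_combination M.pstep_reversible hlam n x y

variable {M}

namespace GreenBounds

variable {c C : ℝ}

theorem green_pos (hG : M.GreenBounds c C) (hc : 0 < c) (x y : M.V) : 0 < M.green x y := by
  by_cases h : x = y
  · exact h ▸ hc.trans_le (hG.1 x).1
  · exact (mul_pos hc (rpow_pos_of_pos (M.d_pos x y h) _)).trans_le (hG.2 x y h).1

theorem lamTot_ne_zero (hG : M.GreenBounds c C) (hc : 0 < c) (x : M.V) : M.lamTot x ≠ 0 := by
  intro h
  have := hG.green_pos hc x x
  simp [green, h] at this

theorem summable_pstep (hG : M.GreenBounds c C) (hc : 0 < c) (x y : M.V) :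
    Summable fun n => M.pstep n x y := by
  by_contra h
  have := hG.green_pos hc x y
  simp [green, tsum_eq_zero_of_not_summable h] at this

theorem tsum_pstep (hG : M.GreenBounds c C) (hc : 0 < c) (x y : M.V) :
    ∑' n, M.pstep n x y =
      (if x = y then 1 else 0) + M.avg (fun z => ∑' n, M.pstep n z y) x := by
  rw [(hG.summable_pstep hc x y).tsum_eq_zero_add, M.avg_tsum fun z => hG.summable_pstep hc z y]
  simp only [pstep_succ]
  rfl

theorem green_eq_avg (hG : M.GreenBounds c C) (hc : 0 < c) {x y : M.V} (hxy : x ≠ y) :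
    M.green x y = M.avg (fun z => M.green z y) x := by
  simp only [green, div_eq_mul_inv, avg_mul_const]
  rw [hG.tsum_pstep hc, if_neg hxy, zero_add]

/-- Neighbours in the graph are at bounded distance. -/
theorem exists_nbr_bound (hG : M.GreenBounds c C) (hc : 0 < c) (hC : 0 < C) (hν : 1 ≤ M.ν) :
    ∃ D > 0, ∀ x y, 0 < M.lam x y → M.d x y ≤ D := by
  obtain ⟨c₀, hc₀, hctrl⟩ := M.ctrl
  have hD : 0 < C / (c₀ * c) := by positivity
  refine ⟨(C / (c₀ * c)) ^ (1 / M.ν), by positivity, fun x y hxy => ?_⟩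
  by_cases h : x = y
  · rw [h, M.d_self]; positivity
  have hd := M.d_pos x y h
  have h1 : c₀ * c ≤ M.green x y := by
    rw [hG.green_eq_avg hc h]
    have hp : c₀ ≤ M.p x y := by
      rw [p, le_div_iff₀ ((M.lamTot_nonneg x).lt_of_ne' (hG.lamTot_ne_zero hc x))]
      exact hctrl x y hxy
    refine (mul_le_mul hp (hG.1 y).1 hc.le (M.p_nonneg x y)).trans ?_
    exact Finset.single_le_sum (f := fun z => M.p x z * M.green z y)
      (fun z _ => mul_nonneg (M.p_nonneg x z) (hG.green_pos hc z y).le) (M.mem_nbr.2 hxy)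
  have h2 := h1.trans (hG.2 x y h).2
  rw [rpow_neg hd.le, ← div_eq_mul_inv, le_div_iff₀ (by positivity)] at h2
  have h3 : M.d x y ^ M.ν ≤ C / (c₀ * c) := by
    rw [le_div_iff₀ (by positivity)]; linarith
  have h4 := rpow_le_rpow (by positivity) h3 (by positivity : 0 ≤ 1 / M.ν)
  rwa [← rpow_mul hd.le, mul_one_div_cancel (by linarith), rpow_one] at h4

end GreenBounds

theorem ball_finite (hlam : ∀ x, M.lamTot x ≠ 0) (hV : M.VolGrowth) (x : M.V) (r : ℝ) :
    (M.ball x r).Finite := by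
  obtain ⟨c, hc, C, hC, h⟩ := hV
  have hsub : M.ball x r ⊆ M.ball x (max r 1) := fun y hy => by
    exact le_trans (show M.d x y ≤ r from hy) (le_max_left _ _)
  refine Set.Finite.subset ?_ hsub
  by_contra hinf
  have h1 := (h x (max r 1) (le_max_right _ _)).1
  rw [finsum_mem_eq_zero_of_infinite] at h1
  · have : 0 < c * max r 1 ^ M.α := by positivity
    linarith
  · rwa [Function.support_eq_univ hlam, Set.inter_univ]

/-! ## First passage decomposition -/

variable (M) in
/-- The probability that the walk from `z` hits `x` at time `n`, before hitting `O`. -/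
def hitAt (x : M.V) (O : Set M.V) : ℕ → M.V → ℝ
  | 0, z => if z = x ∧ x ∉ O then 1 else 0
  | n + 1, z => if z ∉ O ∧ z ≠ x then M.avg (hitAt x O n) z else 0

variable (M) in
/-- The contribution of a single trajectory to `hitBefore`. -/
def hitTerm (z x : M.V) (O : Set M.V) {n : ℕ} (γ : Fin (n + 1) → M.V) : ℝ :=
  if γ 0 = z ∧ γ (Fin.last n) = x ∧ x ∉ O ∧
      (∀ i : Fin (n + 1), i ≠ Fin.last n → γ i ∉ O ∧ γ i ≠ x)
    then M.pathWt γ else 0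

theorem hitTerm_cons (z x : M.V) (O : Set M.V) {n : ℕ} (γ : Fin (n + 1) → M.V) :
    M.hitTerm z x O (Fin.cons z γ : Fin (n + 2) → M.V) =
      if z ∉ O ∧ z ≠ x then M.avg (fun y => M.hitTerm y x O γ) z else 0 := by
  have havg : M.avg (fun y => M.hitTerm y x O γ) z =
      M.p z (γ 0) * M.hitTerm (γ 0) x O γ := by
    rw [avg, Finset.sum_eq_single (γ 0)]
    · intro y _ hy
      rw [hitTerm, if_neg (fun h => hy h.1.symm), mul_zero]
    · intro h
      rw [M.p_eq_zero_of_notMem h, zero_mul]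
  have hwt : M.pathWt (Fin.cons z γ : Fin (n + 2) → M.V) = M.p z (γ 0) * M.pathWt γ := by
    rw [pathWt, Fin.prod_univ_succ]
    simp [pathWt]
  have hforall : (∀ i : Fin (n + 2), i ≠ Fin.last (n + 1) →
      (Fin.cons z γ : Fin (n + 2) → M.V) i ∉ O ∧ (Fin.cons z γ : Fin (n + 2) → M.V) i ≠ x) ↔
      (z ∉ O ∧ z ≠ x) ∧ ∀ i : Fin (n + 1), i ≠ Fin.last n → γ i ∉ O ∧ γ i ≠ x := by
    rw [Fin.forall_fin_succ]
    simp [← Fin.succ_last, (Fin.succ_ne_zero _).symm]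
  rw [havg]
  rw [hitTerm, hitTerm, hwt]
  simp only [hforall]
  rw [← Fin.succ_last, Fin.cons_succ, Fin.cons_zero]
  by_cases h1 : z ∉ O ∧ z ≠ x
  · simp only [h1, true_and, and_self, if_true, mul_ite, mul_zero, ne_eq, not_false_eq_true]
  · simp only [h1, false_and, and_false, if_false]

theorem hasSum_hitTerm (x : M.V) (O : Set M.V) (n : ℕ) (z : M.V) :
    HasSum (fun γ : Fin (n + 1) → M.V => M.hitTerm z x O γ) (M.hitAt x O n z) := by
  induction n generalizing z with
  | zero =>
    have h0 : M.hitAt x O 0 z = M.hitTerm z x O (fun _ : Fin 1 => z) := by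
      simp [hitAt, hitTerm, pathWt]
    rw [h0]
    refine hasSum_single (f := fun γ : Fin 1 → M.V => M.hitTerm z x O γ) _
      fun γ hγ => if_neg fun h => hγ ?_
    funext i
    rw [Subsingleton.elim i 0, h.1]
  | succ n ih =>
    have hinj : Function.Injective
        (fun γ : Fin (n + 1) → M.V => (Fin.cons z γ : Fin (n + 2) → M.V)) :=
      fun γ γ' h => Fin.cons_right_injective (α := fun _ => M.V) z h
    rw [← hinj.hasSum_iff]
    · simp only [Function.comp_def, hitTerm_cons, hitAt]
      split_ifs
      · exact hasSum_sum fun y _ => (ih y).mul_left _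
      · exact hasSum_zero
    · intro γ hγ
      refine if_neg fun h => hγ ⟨Fin.tail γ, ?_⟩
      rw [← h.1]
      exact Fin.cons_self_tail γ

theorem hitBefore_eq_tsum (z x : M.V) (O : Set M.V) :
    M.hitBefore z x O = ∑' n, M.hitAt x O n z :=
  tsum_congr fun n => (hasSum_hitTerm x O n z).tsum_eq

theorem hitAt_nonneg (x : M.V) (O : Set M.V) (n : ℕ) (z : M.V) : 0 ≤ M.hitAt x O n z := by
  induction n generalizing z with
  | zero => simp only [hitAt]; split_ifs <;> simp
  | succ n ih =>
    simp only [hitAt]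
    split_ifs
    · exact M.avg_nonneg ih z
    · exact le_rfl

theorem sum_hitAt_succ_le (x : M.V) (O : Set M.V) (n : ℕ) (z : M.V) :
    ∑ k ∈ Finset.range n, M.hitAt x O (k + 1) z ≤
      M.avg (fun y => ∑ k ∈ Finset.range n, M.hitAt x O k y) z := by
  rw [avg_finset_sum]
  refine Finset.sum_le_sum fun k _ => ?_
  simp only [hitAt]
  split_ifs
  · exact le_rfl
  · exact M.avg_nonneg (hitAt_nonneg x O k) z

theorem sum_hitAt_self_le (x : M.V) (O : Set M.V) (n : ℕ) :
    ∑ k ∈ Finset.range n, M.hitAt x O k x ≤ 1 := by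
  cases n with
  | zero => simp
  | succ n =>
    rw [Finset.sum_range_succ']
    simp only [hitAt]
    simp
    split_ifs <;> simp

namespace GreenBounds

variable {c C : ℝ}

theorem sum_hitAt_mul_le (hG : M.GreenBounds c C) (hc : 0 < c) (x : M.V) (O : Set M.V) (n : ℕ)
    (z : M.V) :
    (∑ k ∈ Finset.range n, M.hitAt x O k z) * M.green x x ≤ M.green z x := by
  induction n generalizing z with
  | zero => simpa using (hG.green_pos hc z x).le
  | succ n ih =>
    by_cases hz : z = x
    · subst hz
      exact mul_le_of_le_one_left (hG.green_pos hc z z).le (sum_hitAt_self_le z O _)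
    · rw [Finset.sum_range_succ', hG.green_eq_avg hc hz]
      have h0 : M.hitAt x O 0 z = 0 := by simp [hitAt, hz]
      rw [h0, add_zero]
      refine (mul_le_mul_of_nonneg_right (sum_hitAt_succ_le x O n z)
        (hG.green_pos hc x x).le).trans ?_
      rw [← avg_mul_const]
      exact M.avg_mono ih z

theorem summable_hitAt (hG : M.GreenBounds c C) (hc : 0 < c) (x : M.V) (O : Set M.V)
    (z : M.V) : Summable fun n => M.hitAt x O n z :=
  summable_of_sum_range_le (fun n => hitAt_nonneg x O n z) fun n =>
    (le_div_iff₀ (hG.green_pos hc x x)).2 (hG.sum_hitAt_mul_le hc x O n z)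

theorem hitBefore_le (hG : M.GreenBounds c C) (hc : 0 < c) (x : M.V) (O : Set M.V) (z : M.V) :
    M.hitBefore z x O ≤ M.green z x / M.green x x := by
  rw [hitBefore_eq_tsum]
  exact Real.tsum_le_of_sum_range_le (fun n => hitAt_nonneg x O n z) fun n =>
    (le_div_iff₀ (hG.green_pos hc x x)).2 (hG.sum_hitAt_mul_le hc x O n z)

theorem hitBefore_le_avg (hG : M.GreenBounds c C) (hc : 0 < c) {x z : M.V} (O : Set M.V)
    (hz : z ≠ x) : M.hitBefore z x O ≤ M.avg (fun y => M.hitBefore y x O) z := by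
  simp only [hitBefore_eq_tsum]
  rw [(hG.summable_hitAt hc x O z).tsum_eq_zero_add, M.avg_tsum (hG.summable_hitAt hc x O)]
  have h0 : M.hitAt x O 0 z = 0 := by simp [hitAt, hz]
  rw [h0, zero_add]
  refine Summable.tsum_le_tsum (fun n => ?_)
    ((summable_nat_add_iff (f := fun n => M.hitAt x O n z) 1).2 (hG.summable_hitAt hc x O z))
    (M.summable_avg (hG.summable_hitAt hc x O) z)
  simp only [hitAt]
  split_ifs
  · exact le_rfl
  · exact M.avg_nonneg (hitAt_nonneg x O n) z

end GreenBounds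

theorem hitBefore_eq_zero {z x : M.V} {O : Set M.V} (hz : z ∈ O) : M.hitBefore z x O = 0 := by
  rw [hitBefore_eq_tsum]
  refine (tsum_congr fun n => ?_).trans tsum_zero
  cases n with
  | zero => exact if_neg fun h => h.2 (h.1 ▸ hz)
  | succ n => exact if_neg fun h => h.1 hz

/-! ## Capacity -/

/-- The variational problem for a symmetric quadratic form on the standard simplex: it has a
minimizer, whose potential is constant on its support. -/
theorem exists_minimizer {ι : Type*} [Fintype ι] [Nonempty ι] (g : ι → ι → ℝ)
    (hg : ∀ i j, g i j = g j i) :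
    ∃ μ ∈ stdSimplex ℝ ι,
      (∀ ρ ∈ stdSimplex ℝ ι, ∑ i, ∑ j, μ i * g i j * μ j ≤ ∑ i, ∑ j, ρ i * g i j * ρ j) ∧
      ∀ i, μ i ≠ 0 → ∑ j, g i j * μ j = ∑ i, ∑ j, μ i * g i j * μ j := by
  obtain ⟨μ, hμ, hmin⟩ := (isCompact_stdSimplex ℝ ι).exists_isMinOn
    ⟨_, single_mem_stdSimplex ℝ (Classical.arbitrary ι)⟩
    (f := fun ρ : ι → ℝ => ∑ i, ∑ j, ρ i * g i j * ρ j) (by fun_prop)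
  rw [isMinOn_iff] at hmin
  refine ⟨μ, hμ, hmin, ?_⟩
  set E := ∑ i, ∑ j, μ i * g i j * μ j with hE
  have hpot : ∑ i, μ i * ∑ j, g i j * μ j = E := by
    simp only [hE, Finset.mul_sum, mul_assoc]
  have hge : ∀ v, E ≤ ∑ j, g v j * μ j := by
    intro v
    set a := ∑ j, g v j * μ j with ha
    have hquad : ∀ t ∈ Set.Ioc (0 : ℝ) 1, 0 ≤ 2 * (a - E) + t * (E - 2 * a + g v v) := by
      rintro t ⟨ht0, ht1⟩
      set δ : ι → ℝ := Pi.single v 1 with hδ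
      have hs : ∀ f : ι → ℝ, ∑ i, δ i * f i = f v := fun f => by
        simp [hδ, Pi.single_apply]
      have h1 := hmin _ ((convex_stdSimplex ℝ ι) hμ (single_mem_stdSimplex ℝ v)
        (sub_nonneg.2 ht1) ht0.le (by ring))
      have hsplit : ∀ i j, ((1 - t) • μ + t • δ) i * g i j * ((1 - t) • μ + t • δ) j =
          (1 - t) ^ 2 * (μ i * g i j * μ j) + t * (1 - t) * (δ i * (g i j * μ j)) +
          t * (1 - t) * (δ j * (g j i * μ i)) + t ^ 2 * (δ i * (δ j * g i j)) := by
        intro i j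
        simp only [Pi.add_apply, Pi.smul_apply, smul_eq_mul, hg j i]
        ring
      have h2 : ∑ i, ∑ j, ((1 - t) • μ + t • δ) i * g i j * ((1 - t) • μ + t • δ) j =
          (1 - t) ^ 2 * E + 2 * t * (1 - t) * a + t ^ 2 * g v v := by
        simp only [hsplit, Finset.sum_add_distrib, ← Finset.mul_sum, hs]
        rw [← hE, ← ha]
        ring
      rw [h2] at h1
      have h3 : 0 ≤ t * (2 * (a - E) + t * (E - 2 * a + g v v)) := by linarith
      exact nonneg_of_mul_nonneg_right h3 ht0
    by_contra! hlt
    set b := E - 2 * a + g v v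
    have hb := hquad (min 1 ((E - a) / (|b| + 1))) ⟨by
      refine lt_min one_pos (div_pos (by linarith) (by positivity)), min_le_left _ _⟩
    have h5 : min 1 ((E - a) / (|b| + 1)) * b ≤ E - a := by
      have h6 : 0 ≤ min 1 ((E - a) / (|b| + 1)) :=
        le_min zero_le_one (div_nonneg (by linarith) (by positivity))
      calc _ ≤ min 1 ((E - a) / (|b| + 1)) * (|b| + 1) := by
            gcongr; linarith [le_abs_self b]
        _ ≤ (E - a) / (|b| + 1) * (|b| + 1) := by gcongr; exact min_le_right _ _
        _ = E - a := div_mul_cancel₀ _ (by positivity)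
    linarith
  intro i hi
  have hzero : ∑ i, μ i * (∑ j, g i j * μ j - E) = 0 := by
    simp only [mul_sub, Finset.sum_sub_distrib, hpot, ← Finset.sum_mul, hμ.2]
    ring
  have h0 := (Finset.sum_eq_zero_iff_of_nonneg fun k _ =>
    mul_nonneg (hμ.1 k) (sub_nonneg.2 (hge k))).1 hzero i (Finset.mem_univ i)
  linarith [(mul_eq_zero.1 h0).resolve_left hi]

/-- A set of capacity at least `κ` carries a measure of mass at least `κ / 2` whose potential
equals `1` on its support. -/
theorem exists_equilibrium (hg : ∀ x y, M.green x y = M.green y x) {S : Set M.V} {κ : ℝ}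
    (hκ : 0 < κ) (hS : κ ≤ M.cap S) :
    ∃ (K : Finset M.V) (e : M.V → ℝ), ↑K ⊆ S ∧ (∀ y, 0 ≤ e y) ∧ κ / 2 ≤ ∑ y ∈ K, e y ∧
      ∀ z ∈ K, ∑ y ∈ K, M.green z y * e y = 1 := by
  have : Nonempty {K : Finset M.V // ↑K ⊆ S} := ⟨⟨∅, by simp⟩⟩
  obtain ⟨⟨K, hKS⟩, hK⟩ := exists_lt_of_lt_ciSup (show κ / 2 < M.cap S by linarith)
  simp only at hK
  have hKne : K.Nonempty := by
    by_contra hne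
    rw [Finset.not_nonempty_iff_eq_empty] at hne
    simp [capFinset, hne] at hK
    linarith
  have : Nonempty K := hKne.to_subtype
  obtain ⟨μ, hμ, hmin, hpot⟩ := exists_minimizer (fun i j : K => M.green i j)
    fun i j => hg i j
  set E := ∑ i : K, ∑ j : K, μ i * M.green i j * μ j with hE
  let wt : M.V → ℝ := fun y => if h : y ∈ K then μ ⟨y, h⟩ else 0
  have hwt : ∀ i : K, wt i = μ i := fun i => by simp [wt]
  have hcap : M.capFinset K = E⁻¹ := by
    rw [capFinset]
    congr 1
    refine IsLeast.csInf_eq ⟨⟨wt, fun y => ?_, fun y hy => by simp [wt, hy], ?_, ?_⟩, ?_⟩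
    · simp only [wt]
      split_ifs
      exacts [hμ.1 _, le_rfl]
    · rw [← Finset.sum_coe_sort]
      simpa only [hwt] using hμ.2
    · rw [← Finset.sum_coe_sort]
      simp only [← Finset.sum_coe_sort K, hwt]
      rfl
    · rintro _ ⟨ρ, hρ0, -, hρ1, rfl⟩
      have h1 : (fun i : K => ρ i) ∈ stdSimplex ℝ K :=
        ⟨fun i => hρ0 i, by rw [← hρ1, ← Finset.sum_coe_sort K]⟩
      have h2 := hmin _ h1
      simpa only [← Finset.sum_coe_sort K] using h2
  rw [hcap] at hK
  have hEpos : 0 < E := inv_pos.1 (by linarith)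
  have hsub : ∀ f : M.V → ℝ, ∑ y ∈ K with wt y ≠ 0, f y * wt y = ∑ y ∈ K, f y * wt y := by
    intro f
    refine Finset.sum_filter_of_ne fun y _ hy h => hy ?_
    rw [h, mul_zero]
  refine ⟨K.filter fun y => wt y ≠ 0, fun y => E⁻¹ * wt y, fun y hy => hKS ?_, fun y => ?_,
    ?_, fun z hz => ?_⟩
  · exact (Finset.mem_filter.1 hy).1
  · refine mul_nonneg (inv_nonneg.2 hEpos.le) ?_
    simp only [wt]
    split_ifs
    exacts [hμ.1 _, le_rfl]
  · rw [hsub, ← Finset.mul_sum, ← Finset.sum_coe_sort]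
    simp only [hwt, hμ.2]
    linarith
  · obtain ⟨hzK, hz0⟩ := Finset.mem_filter.1 hz
    simp only [← mul_assoc]
    rw [hsub, ← Finset.sum_coe_sort]
    have h1 := hpot ⟨z, hzK⟩ (by rwa [← hwt])
    simp only [hwt]
    calc ∑ y : K, M.green z y * E⁻¹ * μ y = E⁻¹ * ∑ y : K, M.green z y * μ y := by
          rw [Finset.mul_sum]; exact Finset.sum_congr rfl fun y _ => by ring
      _ = 1 := by rw [h1]; exact inv_mul_cancel₀ hEpos.ne'

/-- If a finite set `D` around a ball `B(y,L)` is surrounded by points at distance more than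
`(t+1)L` from `y` where `hitBefore` is at most `b`, then on `B(y,L) ∩ D` the bound `b` improves
by a factor which is exponentially small in the capacity of `O ∩ B(y,L)`. -/
theorem GreenBounds.hitBefore_le_exp {c C t L κ b : ℝ} (hG : M.GreenBounds c C) (hc : 0 < c)
    (hC : 0 < C) (hν : 1 ≤ M.ν) (ht : 0 < t) (htC : C * t ^ (-M.ν) ≤ c * 2 ^ (-M.ν) / 2)
    (hL : 1 ≤ L) (hκ : 0 < κ) (hb : 0 ≤ b) {x y : M.V} {O D : Set M.V} (hD : D.Finite)
    (hx : x ∉ D) (hcap : κ ≤ M.cap (O ∩ {z | M.d y z ≤ L}))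
    (hout : ∀ w ∈ D, ∀ v, 0 < M.lam w v →
      v ∈ D ∨ ((t + 1) * L < M.d y v ∧ M.hitBefore v x O ≤ b))
    {z : M.V} (hz : z ∈ D) (hyz : M.d y z ≤ L) :
    M.hitBefore z x O ≤ b * Real.exp (-(c * 2 ^ (-M.ν) / 4 * κ * L ^ (-M.ν))) := by
  have hlam := hG.lamTot_ne_zero hc
  have hL0 : 0 < L := by linarith
  obtain ⟨K, e, hKS, he, hmass, hpot⟩ := exists_equilibrium (M.green_symm hlam) hκ hcap
  set m := ∑ u ∈ K, e u with hm
  have hm0 : 0 < m := by linarith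
  set ψ : M.V → ℝ := fun w => ∑ u ∈ K, M.green w u * e u with hψ
  set s := C * (t * L) ^ (-M.ν) * m with hs
  have hs0 : 0 ≤ s := by positivity
  have hψs : ∀ v, (t + 1) * L < M.d y v → ψ v ≤ s := by
    intro v hv
    rw [hs, hm, Finset.mul_sum]
    refine Finset.sum_le_sum fun u hu => mul_le_mul_of_nonneg_right ?_ (he u)
    have hyu : M.d y u ≤ L := (hKS hu).2
    have hvu : t * L ≤ M.d v u := by
      have := M.d_triangle y u v
      rw [M.d_symm u v] at this
      linarith
    have hne : v ≠ u := by
      rintro rfl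
      rw [M.d_self] at hvu
      exact absurd hvu (not_le.2 (by positivity))
    refine (hG.2 v u hne).2.trans (mul_le_mul_of_nonneg_left ?_ hC.le)
    exact rpow_le_rpow_of_nonpos (by positivity) hvu (by linarith)
  have hψz : c * (2 * L) ^ (-M.ν) * m ≤ ψ z := by
    rw [hm, Finset.mul_sum]
    refine Finset.sum_le_sum fun u hu => mul_le_mul_of_nonneg_right ?_ (he u)
    have hyu : M.d y u ≤ L := (hKS hu).2
    by_cases h : z = u
    · subst h
      refine le_trans ?_ (hG.1 z).1
      exact mul_le_of_le_one_right hc.le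
        (rpow_le_one_of_one_le_of_nonpos (by linarith) (by linarith))
    · refine le_trans (mul_le_mul_of_nonneg_left ?_ hc.le) (hG.2 z u h).1
      refine rpow_le_rpow_of_nonpos (M.d_pos z u h) ?_ (by linarith)
      have := M.d_triangle z y u
      rw [M.d_symm z y] at this
      linarith
  have hmax : M.hitBefore z x O + b * ψ z ≤ b * (1 + s) := by
    refine M.maximum_principle hlam hD hx (f := fun w => M.hitBefore w x O + b * ψ w)
      (fun w hw => ?_) hz
    by_cases hwK : w ∈ K
    · left
      have hw1 : ψ w = 1 := hpot w hwK
      simp only [hitBefore_eq_zero (hKS hwK).1, hw1]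
      nlinarith
    · right
      refine ⟨?_, fun v hv => (hout w hw v hv).imp_right fun h => ?_⟩
      · have hψw : ψ w = M.avg ψ w := by
          rw [hψ, avg_finset_sum]
          refine Finset.sum_congr rfl fun u hu => ?_
          rw [avg_mul_const, ← hG.green_eq_avg hc (fun h : w = u => hwK (h ▸ hu))]
        rw [avg_add, avg_const_mul, ← hψw]
        have := hG.hitBefore_le_avg hc (x := x) (z := w) O (fun h => hx (h ▸ hw))
        linarith
      · have := mul_le_mul_of_nonneg_left (hψs v h.1) hb
        linarith [h.2]
  have hgap : 1 + s - ψ z ≤ Real.exp (-(c * 2 ^ (-M.ν) / 4 * κ * L ^ (-M.ν))) := by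
    have h1 := Real.add_one_le_exp (-(c * 2 ^ (-M.ν) / 4 * κ * L ^ (-M.ν)))
    rw [mul_rpow zero_le_two hL0.le] at hψz
    rw [mul_rpow ht.le hL0.le] at hs
    have hLν : 0 < L ^ (-M.ν) := by positivity
    have h2 : s ≤ c * 2 ^ (-M.ν) / 2 * (L ^ (-M.ν) * m) := by
      calc s = C * t ^ (-M.ν) * (L ^ (-M.ν) * m) := by rw [hs]; ring
        _ ≤ _ := mul_le_mul_of_nonneg_right htC (by positivity)
    have h3 : c * 2 ^ (-M.ν) / 2 * L ^ (-M.ν) * (κ / 2) ≤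
        c * 2 ^ (-M.ν) / 2 * L ^ (-M.ν) * m :=
      mul_le_mul_of_nonneg_left hmass (by positivity)
    linarith
  calc M.hitBefore z x O ≤ b * (1 + s - ψ z) := by linarith
    _ ≤ _ := mul_le_mul_of_nonneg_left hgap hb

end WGraph

namespace LGraph

/-- Every lattice path from `y` to the complement of `B_R` contains at least `k` points of
`B_R \ F` around which `O` has capacity at least `κ`. -/
def NeedsGood (M : LGraph) (O : Set M.V) (L R κ : ℝ) (F : Set M.V) (k : ℕ) (y : M.V) : Prop :=
  ∀ (m : ℕ) (pa : Fin (m + 1) → M.V), pa 0 = y → R < M.d M.o (pa (Fin.last m)) →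
    (∀ i, pa i ∈ M.Lat L) →
    (∀ i : Fin m, ∃ u v, M.d (pa i.castSucc) u ≤ L ∧ M.d (pa i.succ) v ≤ L ∧ 0 < M.lam u v) →
    ∃ A : Finset M.V, (∀ a ∈ A, (∃ i, pa i = a) ∧ M.d M.o a ≤ R ∧ a ∉ F ∧
      κ ≤ M.toWGraph.cap (O ∩ {z | M.d a z ≤ L})) ∧ k ≤ A.card

variable {M : LGraph} {O F : Set M.V} {L R κ : ℝ} {k : ℕ} {y : M.V}

theorem NeedsGood.step (h : M.NeedsGood O L R κ F k y) (hy : y ∈ M.Lat L) {y' w w' : M.V}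
    (hw : M.d y w ≤ L) (hw' : M.d y' w' ≤ L) (hww' : 0 < M.lam w w')
    (hyF : M.d M.o y ≤ R → κ ≤ M.toWGraph.cap (O ∩ {z | M.d y z ≤ L}) → y ∈ F) :
    M.NeedsGood O L R κ F k y' := by
  intro m pa h0 hlast hlat hadj
  obtain ⟨A, hA, hk⟩ := h (m + 1) (Fin.cons y pa) rfl (by rwa [← Fin.succ_last, Fin.cons_succ])
    (Fin.cases hy hlat) (Fin.cases ⟨w, w', hw, by simpa [h0] using hw', hww'⟩ fun i => by
      simpa [← Fin.succ_castSucc] using hadj i)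
  refine ⟨A, fun a ha => ?_, hk⟩
  obtain ⟨⟨i, hi⟩, h1, h2, h3⟩ := hA a ha
  refine ⟨?_, h1, h2, h3⟩
  cases i using Fin.cases with
  | zero =>
    have hya : y = a := hi
    subst hya
    exact absurd (hyF h1 h3) h2
  | succ i => exact ⟨i, hi⟩

theorem NeedsGood.union {T : Set M.V} (h : M.NeedsGood O L R κ F k y) (hT : T.Finite) {N : ℕ}
    (hN : T.ncard ≤ N) : M.NeedsGood O L R κ (F ∪ T) (k - N) y := by
  intro m pa h0 hlast hlat hadj
  obtain ⟨A, hA, hk⟩ := h m pa h0 hlast hlat hadj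
  refine ⟨A \ hT.toFinset, fun a ha => ?_, ?_⟩
  · rw [Finset.mem_sdiff, Set.Finite.mem_toFinset] at ha
    obtain ⟨h1, h2, h3, h4⟩ := hA a ha.1
    exact ⟨h1, h2, fun h => h.elim h3 ha.2, h4⟩
  · have := Finset.le_card_sdiff hT.toFinset A
    rw [← Set.ncard_eq_toFinset_card T hT] at this
    omega

theorem NeedsGood.dist_le (h : M.NeedsGood O L R κ F k y) (hk : 0 < k) (hy : y ∈ M.Lat L) :
    M.d M.o y ≤ R := by
  by_contra! hlt
  obtain ⟨A, hA, hkA⟩ := h 0 (fun _ => y) rfl hlt (fun _ => hy) (fun i => i.elim0)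
  obtain ⟨a, ha⟩ := Finset.card_pos.1 (hk.trans_le hkA)
  obtain ⟨⟨_, rfl⟩, h1, -⟩ := hA a ha
  linarith

theorem NeedsGood.hitBefore_le {c C t D₀ b : ℝ} {N N₀ : ℕ} (hG : M.toWGraph.GreenBounds c C)
    (hc : 0 < c) (hC : 0 < C) (hν : 1 ≤ M.ν) (hV : M.toWGraph.VolGrowth) (ht : 0 < t)
    (htC : C * t ^ (-M.ν) ≤ c * 2 ^ (-M.ν) / 2) (hD₀ : 0 < D₀)
    (hnbr : ∀ u v, 0 < M.lam u v → M.d u v ≤ D₀) (hN : t + 2 ≤ N)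
    (hL : 1 ≤ L) (hκ : 0 < κ)
    (hfin : ∀ u, {v | v ∈ M.Lat L ∧ M.d u v ≤ L * N}.Finite)
    (hcard : ∀ u, {v | v ∈ M.Lat L ∧ M.d u v ≤ L * N}.ncard ≤ N₀)
    (hb : 0 ≤ b) {x : M.V} (hx : R + (t + 1 + D₀) * L < M.d M.o x)
    (hbd : ∀ z, M.d M.o z ≤ R + (t + 1 + D₀) * L → M.toWGraph.hitBefore z x O ≤ b)
    (j : ℕ) {z : M.V} (hk : j * N₀ < k + N₀) (h : M.NeedsGood O L R κ F k y)
    (hy : y ∈ M.Lat L) (hyz : M.d y z ≤ L) (hz : M.d M.o z ≤ R + (t + 1 + D₀) * L) :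
    M.toWGraph.hitBefore z x O ≤
      b * Real.exp (-(c * 2 ^ (-M.ν) / 4 * κ * L ^ (-M.ν))) ^ j := by
  have hlam := hG.lamTot_ne_zero hc
  set q := Real.exp (-(c * 2 ^ (-M.ν) / 4 * κ * L ^ (-M.ν))) with hq
  have htL : 0 < t * L := by positivity
  have hDL : 0 < D₀ * L := by positivity
  have hDL' : D₀ ≤ D₀ * L := le_mul_of_one_le_right hD₀.le hL
  have hNL : (t + 2) * L ≤ L * N := by
    rw [mul_comm L]
    exact mul_le_mul_of_nonneg_right hN (by linarith)
  induction j generalizing F k y z with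
  | zero => simpa using hbd z hz
  | succ j ih =>
    have hkj : j * N₀ < k := by
      rw [add_mul, one_mul] at hk
      omega
    refine M.toWGraph.maximum_principle hlam
      (D := {w | ∃ y ∈ M.Lat L, M.d y w ≤ L ∧ M.NeedsGood O L R κ F k y}) (a := x) ?_ ?_
      (f := fun w => M.toWGraph.hitBefore w x O) ?_ ⟨y, hy, hyz, h⟩
    · refine (M.toWGraph.ball_finite hlam hV M.o (R + L)).subset ?_
      rintro w ⟨u, hu, huw, hgood⟩
      have h1 := hgood.dist_le (by omega) hu
      have h2 := M.d_triangle M.o u w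
      show M.d M.o w ≤ R + L
      linarith
    · rintro ⟨u, hu, hux, hgood⟩
      have h1 := hgood.dist_le (by omega) hu
      have h2 := M.d_triangle M.o u x
      linarith
    rintro w ⟨u, hu, huw, hgood⟩
    by_cases hex : ∃ y' ∈ M.Lat L, M.d y' w ≤ L ∧ M.NeedsGood O L R κ F k y' ∧
        κ ≤ M.toWGraph.cap (O ∩ {z | M.d y' z ≤ L})
    · left
      obtain ⟨y', hy', hy'w, hgood', hcap⟩ := hex
      have hy'R := hgood'.dist_le (by omega) hy'
      set T := {v | v ∈ M.Lat L ∧ M.d y' v ≤ L * N}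
      have hgoodT := hgood'.union (hfin y') (hcard y')
      rw [pow_succ, ← mul_assoc]
      refine hG.hitBefore_le_exp (L := L) (y := y') (D := {w | M.d y' w ≤ (t + 1) * L ∧
        ∃ u ∈ M.Lat L, M.d u w ≤ L ∧ M.NeedsGood O L R κ (F ∪ T) (k - N₀) u})
        hc hC hν ht htC hL hκ (by positivity) ?_ ?_ hcap ?_
        ⟨by linarith, y', hy', hy'w, hgoodT⟩ hy'w
      · exact (M.toWGraph.ball_finite hlam hV y' ((t + 1) * L)).subset fun w hw => hw.1
      · rintro ⟨h1, -⟩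
        have h2 := M.d_triangle M.o y' x
        linarith
      · rintro w ⟨hw, u, hu, huw, hgood⟩ v hwv
        obtain ⟨u', hu', hu'v⟩ := M.Lat_cover L hL v
        have huT : u ∈ F ∪ T := by
          right
          refine ⟨hu, ?_⟩
          have := M.d_triangle y' w u
          rw [M.d_symm w u] at this
          linarith
        have hgood'' := hgood.step hu huw hu'v hwv fun _ _ => huT
        by_cases hv : M.d y' v ≤ (t + 1) * L
        · exact Or.inl ⟨hv, u', hu', hu'v, hgood''⟩
        · refine Or.inr ⟨not_le.1 hv, ih (by omega) hgood'' hu' hu'v ?_⟩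
          have h1 := M.d_triangle M.o y' v
          have h2 := M.d_triangle y' w v
          have h3 := hnbr w v hwv
          linarith
    · right
      refine ⟨hG.hitBefore_le_avg hc O ?_, fun v hwv => Or.inl ?_⟩
      · rintro rfl
        have h1 := hgood.dist_le (by omega) hu
        have h2 := M.d_triangle M.o u w
        linarith
      · obtain ⟨u', hu', hu'v⟩ := M.Lat_cover L hL v
        exact ⟨u', hu', hu'v, hgood.step hu huw hu'v hwv fun _ hcap =>
          absurd ⟨u, hu, huw, hgood, hcap⟩ hex⟩

theorem GoodObstacle.needsGood {n : ℕ} (h : M.GoodObstacle O L R n κ) :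
    M.NeedsGood O L R κ ∅ n M.o := by
  intro m pa h0 hlast hlat hadj
  obtain ⟨A, hA, hn, hcap⟩ := h m pa ⟨h0, hlast, hlat, hadj⟩
  exact ⟨A, fun a ha => ⟨(hA a ha).1, (hA a ha).2, Set.notMem_empty a, hcap a ha⟩,
    by exact_mod_cast hn⟩

end LGraph

/-- **Lemma 2.1 (random walk avoiding a good obstacle).** -/
theorem walk_avoids_good_obstacle (M : LGraph) (hS : M.toWGraph.Standing)
    (hν1 : 1 ≤ M.ν) (hνα : M.ν ≤ M.α / 2) :
    ∃ C₀ > (0:ℝ), ∃ C > (0:ℝ), ∃ c > (0:ℝ),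
      ∀ (κ L R : ℝ) (n : ℕ) (x : M.V) (O : Set M.V),
        1 ≤ κ → 1 ≤ L → L ≤ R → 1 ≤ n →
        M.GoodObstacle O L R n κ →
        ¬ M.d M.o x ≤ R + C₀ * L →
        M.toWGraph.hitBefore M.o x O ≤
          C * M.toWGraph.dSet x {y | M.d M.o y ≤ R + C₀ * L} ^ (-M.ν) *
            Real.exp (-(c * κ * n / L ^ M.ν)) := by
  obtain ⟨-, hV, c, hc, C, hC, hG'⟩ := hS
  have hG : M.toWGraph.GreenBounds c C := hG'
  have hlam := hG.lamTot_ne_zero hc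
  obtain ⟨D₀, hD₀, hnbr⟩ := hG.exists_nbr_bound hc hC hν1
  obtain ⟨CΛ, hCΛ, hLat⟩ := M.Lat_card
  have ha : 0 < c * 2 ^ (-M.ν) / 4 := by positivity
  set a := c * 2 ^ (-M.ν) / 4 with hadef
  obtain ⟨t, ht, htC⟩ : ∃ t > 0, C * t ^ (-M.ν) ≤ c * 2 ^ (-M.ν) / 2 := by
    refine ⟨C / (2 * a) + 1, by positivity, ?_⟩
    have h1 : (C / (2 * a) + 1) ^ (-M.ν) ≤ (C / (2 * a) + 1)⁻¹ := by
      rw [← rpow_neg_one]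
      exact rpow_le_rpow_of_exponent_le (le_add_of_nonneg_left (by positivity)) (by linarith)
    have h2 : C * (C / (2 * a) + 1)⁻¹ ≤ 2 * a := by
      rw [← div_eq_mul_inv, div_le_iff₀ (by positivity), mul_add,
        mul_div_cancel₀ _ (by positivity)]
      linarith
    calc _ ≤ C * (C / (2 * a) + 1)⁻¹ := mul_le_mul_of_nonneg_left h1 hC.le
      _ ≤ 2 * a := h2
      _ = _ := by rw [hadef]; ring
  obtain ⟨N, hN⟩ := exists_nat_ge (t + 2)
  have hN1 : 1 ≤ N := by
    have : (1 : ℝ) ≤ N := by linarith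
    exact_mod_cast this
  obtain ⟨N₀, hN₀⟩ : ∃ N₀, N₀ = ⌈CΛ * (N : ℝ) ^ M.α⌉₊ := ⟨_, rfl⟩
  have hN₀pos : 0 < N₀ := hN₀ ▸ Nat.ceil_pos.2 (by positivity)
  refine ⟨t + 1 + D₀, by positivity, C / c, by positivity, a / N₀, by positivity, ?_⟩
  intro κ L R n x O hκ hL hLR hn hgood hx
  rw [not_le] at hx
  set δ := M.toWGraph.dSet x {y | M.d M.o y ≤ R + (t + 1 + D₀) * L} with hδ
  have hL0 : 0 < L := by linarith
  have ho : M.d M.o M.o ≤ R + (t + 1 + D₀) * L := by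
    rw [M.d_self]
    have : 0 ≤ (t + 1 + D₀) * L := by positivity
    linarith
  have hfinB : {y | M.d M.o y ≤ R + (t + 1 + D₀) * L}.Finite :=
    M.toWGraph.ball_finite hlam hV M.o _
  have hfinD := hfinB.image (M.d x)
  have hδpos : 0 < δ := by
    obtain ⟨y, hy, hyδ⟩ := Set.Nonempty.csInf_mem ⟨_, Set.mem_image_of_mem (M.d x) ho⟩ hfinD
    rw [hδ, WGraph.dSet, ← hyδ]
    refine M.d_pos x y ?_
    rintro rfl
    exact absurd hx (not_lt.2 hy)
  have hbd : ∀ z, M.d M.o z ≤ R + (t + 1 + D₀) * L →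
      M.toWGraph.hitBefore z x O ≤ C / c * δ ^ (-M.ν) := by
    intro z hz
    have hzx : z ≠ x := by
      rintro rfl
      linarith
    have hle : δ ≤ M.d z x := by
      rw [M.d_symm z x]
      exact csInf_le hfinD.bddBelow (Set.mem_image_of_mem _ hz)
    refine (hG.hitBefore_le hc x O z).trans ?_
    calc M.toWGraph.green z x / M.toWGraph.green x x
        ≤ C * M.d z x ^ (-M.ν) / c :=
          div_le_div₀ (mul_nonneg hC.le (rpow_nonneg (hδpos.le.trans hle) _))
            (hG.2 z x hzx).2 hc (hG.1 x).1
      _ ≤ C * δ ^ (-M.ν) / c := by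
          gcongr C * ?_ / c
          exact rpow_le_rpow_of_nonpos hδpos hle (by linarith)
      _ = _ := by ring
  have hmain := hgood.needsGood.hitBefore_le hG hc hC hν1 hV ht htC hD₀ hnbr hN hL
    (by linarith) (fun u => (hLat L hL u N hN1).1)
    (fun u => hN₀ ▸ Nat.cast_le.1 ((hLat L hL u N hN1).2.trans (Nat.le_ceil _)))
    (by positivity) hx hbd
    ((n + N₀ - 1) / N₀) (z := M.o)
    (by have := Nat.div_mul_le_self (n + N₀ - 1) N₀; omega)
    (M.Lat_base L hL) (by rw [M.d_self]; exact hL0.le) ho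
  refine hmain.trans (mul_le_mul_of_nonneg_left ?_ (by positivity))
  rw [← Real.exp_nat_mul, Real.exp_le_exp, ← hadef, rpow_neg hL0.le]
  have hj : (n : ℝ) / N₀ ≤ ((n + N₀ - 1) / N₀ : ℕ) := by
    rw [div_le_iff₀ (by exact_mod_cast hN₀pos)]
    have h1 := Nat.lt_div_mul_add (a := n + N₀ - 1) hN₀pos
    have : n ≤ (n + N₀ - 1) / N₀ * N₀ := by omega
    exact_mod_cast this
  have hpos : 0 ≤ a * κ * (L ^ M.ν)⁻¹ := by positivity
  have := mul_le_mul_of_nonneg_right hj hpos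
  have heq : a / N₀ * κ * n / L ^ M.ν = n / N₀ * (a * κ * (L ^ M.ν)⁻¹) := by ring
  rw [heq]
  linarith
end
end

section
/- Lemma 4.2 (near-additive lower bound on the capacity of a union of well-separated sets): There exists a constant c > 0 such that for all integers ℓ, L ≥ 2, every I ⊂ {1,…,ℓ}, and all sets S_k ⊂ 𝔸_k (k ∈ I): cap(∪_{k∈I} S_k) ≥ c |I| · min( L^ν (log(1+|I|))^{−b₁}, inf_{k∈I} cap(S_k) ), where b₁ = 1 if ν = 1 and b₁ = 0 otherwise. -/
open MeasureTheory ProbabilityTheory Real Filter Topology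
open scoped ENNReal NNReal BigOperators Classical

noncomputable section

/-! ### Sums of inverse powers of distances in `ℕ` -/

/-- The sum of `|k - j|^{-ν}` over a set of `N` integers `j ≠ k` is, up to constants, largest
when these integers are consecutive. -/
theorem sum_abs_sub_rpow_neg_le {ν : ℝ} (hν : 1 ≤ ν) (I : Finset ℕ) (k : ℕ) :
    ∑ j ∈ I.erase k, |(k:ℝ) - (j:ℝ)| ^ (-ν) ≤
      2 * ∑ i ∈ Finset.Icc 1 I.card, (i:ℝ) ^ (-ν) + 1 := by
  set N := I.card with hN
  have pointwise : ∀ j ∈ I.erase k, |(k:ℝ) - (j:ℝ)| ^ (-ν) ≤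
      ∑ i ∈ Finset.Icc 1 N, ((if j = k + i then (i:ℝ) ^ (-ν) else 0) +
        (if j = k - i then (i:ℝ) ^ (-ν) else 0)) + 1 / N := by
    intro j hj
    obtain ⟨hjk, hjI⟩ := Finset.mem_erase.1 hj
    have hNpos : 0 < N := Finset.card_pos.2 ⟨j, hjI⟩
    have hterm : ∀ i ∈ Finset.Icc 1 N, 0 ≤ ((if j = k + i then (i:ℝ) ^ (-ν) else 0) +
        (if j = k - i then (i:ℝ) ^ (-ν) else 0)) := by
      intro i _
      split_ifs <;> positivity
    obtain ⟨m, hm1, hm, hcase⟩ : ∃ m : ℕ, 1 ≤ m ∧ |(k:ℝ) - (j:ℝ)| = m ∧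
        (j = k + m ∨ j = k - m) := by
      rcases lt_or_gt_of_ne hjk with h | h
      · refine ⟨k - j, by omega, ?_, Or.inr (by omega)⟩
        rw [Nat.cast_sub h.le, abs_of_nonneg (sub_nonneg.2 (by exact_mod_cast h.le))]
      · refine ⟨j - k, by omega, ?_, Or.inl (by omega)⟩
        rw [Nat.cast_sub h.le, abs_sub_comm,
          abs_of_nonneg (sub_nonneg.2 (by exact_mod_cast h.le))]
    rw [hm]
    by_cases hmN : m ≤ N
    · have h1 := Finset.single_le_sum hterm (Finset.mem_Icc.2 ⟨hm1, hmN⟩)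
      have h2 : (m:ℝ) ^ (-ν) ≤ (if j = k + m then (m:ℝ) ^ (-ν) else 0) +
          (if j = k - m then (m:ℝ) ^ (-ν) else 0) := by
        have h0 : 0 ≤ (m:ℝ) ^ (-ν) := by positivity
        rcases hcase with h | h
        · rw [if_pos h]
          split_ifs <;> linarith
        · rw [if_pos h]
          split_ifs <;> linarith
      have h3 : (0:ℝ) ≤ 1 / N := by positivity
      linarith
    · have hNR : (1:ℝ) ≤ N := by exact_mod_cast hNpos
      have hmR : (N:ℝ) ≤ m := by exact_mod_cast (not_le.1 hmN).le
      have h1 : (m:ℝ) ^ (-ν) ≤ 1 / N := by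
        calc (m:ℝ) ^ (-ν) ≤ (m:ℝ) ^ (-1:ℝ) :=
              Real.rpow_le_rpow_of_exponent_le (hNR.trans hmR) (by linarith)
          _ = 1 / m := by rw [Real.rpow_neg_one, one_div]
          _ ≤ 1 / N := one_div_le_one_div_of_le (by linarith) hmR
      have h2 := Finset.sum_nonneg hterm
      linarith
  have delta_sum : ∀ (a : ℕ) (c : ℝ), 0 ≤ c →
      ∑ j ∈ I.erase k, (if j = a then c else 0) ≤ c := by
    intro a c hc
    rw [Finset.sum_ite_eq']
    split_ifs <;> linarith
  calc ∑ j ∈ I.erase k, |(k:ℝ) - (j:ℝ)| ^ (-ν)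
      ≤ ∑ j ∈ I.erase k, (∑ i ∈ Finset.Icc 1 N, ((if j = k + i then (i:ℝ) ^ (-ν) else 0) +
        (if j = k - i then (i:ℝ) ^ (-ν) else 0)) + 1 / N) := Finset.sum_le_sum pointwise
    _ = ∑ i ∈ Finset.Icc 1 N, (∑ j ∈ I.erase k, (if j = k + i then (i:ℝ) ^ (-ν) else 0) +
        ∑ j ∈ I.erase k, (if j = k - i then (i:ℝ) ^ (-ν) else 0)) +
          (I.erase k).card * (1 / (N:ℝ)) := by
        rw [Finset.sum_add_distrib, Finset.sum_comm, Finset.sum_const, nsmul_eq_mul]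
        simp only [Finset.sum_add_distrib]
    _ ≤ ∑ i ∈ Finset.Icc 1 N, ((i:ℝ) ^ (-ν) + (i:ℝ) ^ (-ν)) + 1 := by
        refine add_le_add (Finset.sum_le_sum fun i _ => add_le_add
          (delta_sum _ _ (by positivity)) (delta_sum _ _ (by positivity))) ?_
        have h1 : ((I.erase k).card : ℝ) ≤ N := by exact_mod_cast Finset.card_erase_le
        rw [mul_one_div]
        exact div_le_one_of_le₀ h1 (by positivity)
    _ = 2 * ∑ i ∈ Finset.Icc 1 N, (i:ℝ) ^ (-ν) + 1 := by
        rw [Finset.sum_add_distrib, two_mul]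

theorem exists_sum_rpow_neg_le_log {ν : ℝ} (hν : 1 ≤ ν) :
    ∃ C > (0:ℝ), ∀ N : ℕ, 1 ≤ N →
      2 * ∑ i ∈ Finset.Icc 1 N, (i:ℝ) ^ (-ν) + 1 ≤ C * Real.log (1 + (N:ℝ)) ^ bOne ν := by
  rcases hν.eq_or_lt with h | h
  · subst h
    have hlog2 : 0 < Real.log 2 := Real.log_pos (by norm_num)
    refine ⟨2 + 3 / Real.log 2, by positivity, fun N hN => ?_⟩
    have hNR : (1:ℝ) ≤ N := by exact_mod_cast hN
    have hsum : ∑ i ∈ Finset.Icc 1 N, (i:ℝ) ^ (-1:ℝ) ≤ 1 + Real.log N := by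
      have h1 := harmonic_le_one_add_log N
      rw [harmonic_eq_sum_Icc] at h1
      push_cast at h1
      simpa only [Real.rpow_neg_one] using h1
    have hmono : Real.log N ≤ Real.log (1 + N) := Real.log_le_log (by linarith) (by linarith)
    have hlow : Real.log 2 ≤ Real.log (1 + N) := Real.log_le_log (by norm_num) (by linarith)
    have h3 : 3 ≤ 3 / Real.log 2 * Real.log (1 + N) := by
      rw [div_mul_eq_mul_div, le_div_iff₀ hlog2]
      linarith
    rw [bOne, if_pos rfl, Real.rpow_one, add_mul]
    linarith
  · have hsummable : Summable fun n : ℕ => (n:ℝ) ^ (-ν) :=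
      Real.summable_nat_rpow.2 (by linarith)
    have hpos : 0 ≤ ∑' n : ℕ, (n:ℝ) ^ (-ν) := tsum_nonneg fun n => by positivity
    refine ⟨2 * ∑' n : ℕ, (n:ℝ) ^ (-ν) + 1, by positivity, fun N _ => ?_⟩
    rw [bOne, if_neg h.ne', Real.rpow_zero, mul_one]
    have := hsummable.sum_le_tsum (Finset.Icc 1 N) fun n _ => by positivity
    linarith

namespace WGraph

variable {M : WGraph}

theorem GreenDecay.green_nonneg (hG : M.GreenDecay) (x y : M.V) : 0 ≤ M.green x y := by
  obtain ⟨c, hc, C, hC, hdiag, hoff⟩ := hG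
  by_cases h : x = y
  · subst h
    exact hc.le.trans (hdiag x).1
  · have := M.d_pos x y h
    exact le_trans (by positivity) (hoff x y h).1

/-! ### Energies and capacities of finite sets -/

variable (M) in
/-- The energy `Σ_{x,y ∈ K} μ(x) g(x,y) μ(y)` of a weight `μ` on `K`. -/
def energy (K : Finset M.V) (μ : M.V → ℝ) : ℝ :=
  ∑ x ∈ K, ∑ y ∈ K, μ x * M.green x y * μ y

variable (M) in
/-- Probability weights supported on `K`. -/
def IsProbOn (K : Finset M.V) (μ : M.V → ℝ) : Prop :=
  (∀ x, 0 ≤ μ x) ∧ (∀ x, x ∉ K → μ x = 0) ∧ ∑ x ∈ K, μ x = 1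

theorem capFinset_eq (K : Finset M.V) :
    M.capFinset K = (sInf {E : ℝ | ∃ μ, M.IsProbOn K μ ∧ E = M.energy K μ})⁻¹ := by
  simp only [capFinset, IsProbOn, energy, and_assoc]

theorem GreenDecay.energy_nonneg (hG : M.GreenDecay) (K : Finset M.V) {μ : M.V → ℝ}
    (hμ : ∀ x, 0 ≤ μ x) : 0 ≤ M.energy K μ :=
  Finset.sum_nonneg fun x _ => Finset.sum_nonneg fun y _ =>
    mul_nonneg (mul_nonneg (hμ x) (hG.green_nonneg x y)) (hμ y)

theorem GreenDecay.capFinset_nonneg (hG : M.GreenDecay) (K : Finset M.V) :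
    0 ≤ M.capFinset K := by
  rw [capFinset_eq]
  refine inv_nonneg.2 (Real.sInf_nonneg ?_)
  rintro E ⟨μ, hμ, rfl⟩
  exact hG.energy_nonneg K hμ.1

theorem GreenDecay.cap_nonneg (hG : M.GreenDecay) (S : Set M.V) : 0 ≤ M.cap S :=
  Real.iSup_nonneg fun K => hG.capFinset_nonneg K.1

/-- Energies of probability weights are bounded below, since `g` is on the diagonal. -/
theorem GreenDecay.exists_pos_le_energy (hG : M.GreenDecay) (K : Finset M.V) :
    ∃ e > (0:ℝ), ∀ μ, M.IsProbOn K μ → e ≤ M.energy K μ := by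
  have hnn := hG.green_nonneg
  obtain ⟨c, hc, C, hC, hdiag, hoff⟩ := hG
  refine ⟨c / (K.card + 1), by positivity, fun μ ⟨h0, _, h1⟩ => ?_⟩
  have hcs : (∑ x ∈ K, μ x) ^ 2 ≤ K.card * ∑ x ∈ K, μ x ^ 2 := sq_sum_le_card_mul_sum_sq
  have hdiag' : c * ∑ x ∈ K, μ x ^ 2 ≤ M.energy K μ := by
    rw [Finset.mul_sum, energy]
    refine Finset.sum_le_sum fun x hx => ?_
    have h2 : μ x * M.green x x * μ x ≤ ∑ y ∈ K, μ x * M.green x y * μ y :=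
      Finset.single_le_sum (f := fun y => μ x * M.green x y * μ y)
        (fun y _ => mul_nonneg (mul_nonneg (h0 x) (hnn x y)) (h0 y)) hx
    have h3 := mul_le_mul_of_nonneg_right (hdiag x).1 (sq_nonneg (μ x))
    nlinarith
  rw [h1, one_pow] at hcs
  have hsq : 0 ≤ ∑ x ∈ K, μ x ^ 2 := Finset.sum_nonneg fun x _ => sq_nonneg _
  rw [div_le_iff₀ (by positivity)]
  nlinarith

theorem GreenDecay.inv_le_capFinset (hG : M.GreenDecay) {K : Finset M.V} {μ : M.V → ℝ}
    (hμ : M.IsProbOn K μ) {e : ℝ} (he : M.energy K μ ≤ e) : e⁻¹ ≤ M.capFinset K := by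
  obtain ⟨ε, hε, hle⟩ := hG.exists_pos_le_energy K
  have hbdd : ∀ E ∈ {E : ℝ | ∃ μ, M.IsProbOn K μ ∧ E = M.energy K μ}, ε ≤ E := by
    rintro E ⟨μ', hμ', rfl⟩
    exact hle μ' hμ'
  rw [capFinset_eq]
  refine inv_anti₀ (hε.trans_le (le_csInf ⟨_, μ, hμ, rfl⟩ hbdd)) (le_trans ?_ he)
  exact csInf_le ⟨ε, hbdd⟩ ⟨μ, hμ, rfl⟩

theorem exists_energy_lt_inv {K : Finset M.V} {t : ℝ} (ht : 0 < t) (h : t < M.capFinset K) :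
    ∃ μ, M.IsProbOn K μ ∧ M.energy K μ < t⁻¹ := by
  rw [capFinset_eq] at h
  have hinf : 0 < sInf {E : ℝ | ∃ μ, M.IsProbOn K μ ∧ E = M.energy K μ} :=
    inv_pos.1 (ht.trans h)
  have hne : {E : ℝ | ∃ μ, M.IsProbOn K μ ∧ E = M.energy K μ}.Nonempty := by
    by_contra hempty
    rw [Set.not_nonempty_iff_eq_empty.1 hempty, Real.sInf_empty] at hinf
    exact hinf.false
  obtain ⟨E, ⟨μ, hμ, rfl⟩, hlt⟩ := exists_lt_of_csInf_lt hne ((lt_inv_comm₀ ht hinf).1 h)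
  exact ⟨μ, hμ, hlt⟩

theorem GreenDecay.sq_mass_le (hG : M.GreenDecay) (K : Finset M.V) {μ : M.V → ℝ}
    (hμ : ∀ x, 0 ≤ μ x) : (∑ x ∈ K, μ x) ^ 2 ≤ M.capFinset K * M.energy K μ := by
  set m := ∑ x ∈ K, μ x with hm
  rcases (Finset.sum_nonneg fun x (_ : x ∈ K) => hμ x).eq_or_lt with h | h
  · rw [hm, ← h, zero_pow two_ne_zero]
    exact mul_nonneg (hG.capFinset_nonneg K) (hG.energy_nonneg K hμ)
  · rw [← hm] at h
    let μ' : M.V → ℝ := fun x => if x ∈ K then μ x / m else 0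
    have hμ' : M.IsProbOn K μ' := by
      refine ⟨fun x => ?_, fun x hx => if_neg hx, ?_⟩
      · have := hμ x
        simp only [μ']
        split_ifs <;> positivity
      · rw [Finset.sum_congr rfl fun x hx => if_pos hx, ← Finset.sum_div, ← hm,
          div_self h.ne']
    have henergy : M.energy K μ' = M.energy K μ / m ^ 2 := by
      simp only [energy, Finset.sum_div]
      refine Finset.sum_congr rfl fun x hx => Finset.sum_congr rfl fun y hy => ?_
      simp only [μ', if_pos hx, if_pos hy]
      field_simp
    obtain ⟨ε, hε, hle⟩ := hG.exists_pos_le_energy K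
    have hpos : 0 < M.energy K μ / m ^ 2 := henergy ▸ hε.trans_le (hle μ' hμ')
    have hcap := hG.inv_le_capFinset hμ' henergy.le
    rw [inv_le_iff_one_le_mul₀ hpos, mul_div_assoc', le_div_iff₀ (by positivity),
      one_mul] at hcap
    exact hcap

/-! ### Subadditivity of the capacity -/

/-- The capacity of a finite set is at most the sum of the capacities of the pieces of a
partition of it. -/
theorem GreenDecay.capFinset_le_sum (hG : M.GreenDecay) {ι : Type*} (I : Finset ι)
    (K : Finset M.V) (κ : M.V → ι) (hκ : ∀ x ∈ K, κ x ∈ I) :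
    M.capFinset K ≤ ∑ k ∈ I, M.capFinset (K.filter fun x => κ x = k) := by
  have hB : 0 ≤ ∑ k ∈ I, M.capFinset (K.filter fun x => κ x = k) :=
    Finset.sum_nonneg fun k _ => hG.capFinset_nonneg _
  by_contra! hlt
  obtain ⟨s, hBs, hsK⟩ := exists_between hlt
  obtain ⟨μ, ⟨h0, _, h1⟩, hE⟩ := exists_energy_lt_inv (hB.trans_lt hBs) hsK
  have hs := hB.trans_lt hBs
  have hcs := Finset.sum_sq_le_sum_mul_sum_of_sq_le_mul I
    (r := fun k => ∑ x ∈ K with κ x = k, μ x)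
    (fun k _ => hG.capFinset_nonneg (K.filter fun x => κ x = k))
    (fun k _ => hG.energy_nonneg (K.filter fun x => κ x = k) h0)
    (fun k _ => hG.sq_mass_le (K.filter fun x => κ x = k) h0)
  rw [Finset.sum_fiberwise_of_maps_to hκ, h1, one_pow] at hcs
  have hsum : ∑ k ∈ I, M.energy (K.filter fun x => κ x = k) μ ≤ M.energy K μ := by
    rw [energy, ← Finset.sum_fiberwise_of_maps_to hκ]
    refine Finset.sum_le_sum fun k _ => Finset.sum_le_sum fun x _ =>
      Finset.sum_le_sum_of_subset_of_nonneg (Finset.filter_subset _ _) fun y _ _ =>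
        mul_nonneg (mul_nonneg (h0 x) (hG.green_nonneg x y)) (h0 y)
  have hsE : s * M.energy K μ < 1 := by
    rw [← mul_inv_cancel₀ hs.ne']
    exact mul_lt_mul_of_pos_left hE hs
  have hle := mul_le_mul hBs.le hsum
    (Finset.sum_nonneg fun k _ => hG.energy_nonneg _ h0) hs.le
  linarith

theorem GreenDecay.bddAbove_capFinset_iUnion (hG : M.GreenDecay) {ι : Type*} (I : Finset ι)
    (S : ι → Set M.V)
    (hS : ∀ k ∈ I, BddAbove (Set.range fun K : {K : Finset M.V // ↑K ⊆ S k} =>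
      M.capFinset K.1)) :
    BddAbove (Set.range fun K : {K : Finset M.V // ↑K ⊆ ⋃ k ∈ I, S k} =>
      M.capFinset K.1) := by
  refine ⟨∑ k ∈ I, M.cap (S k), ?_⟩
  rintro _ ⟨⟨K, hK⟩, rfl⟩
  have hex : ∀ x ∈ K, ∃ k ∈ I, x ∈ S k := fun x hx => by simpa using hK hx
  rcases K.eq_empty_or_nonempty with rfl | ⟨x₀, hx₀⟩
  · have h := hG.capFinset_le_sum (∅ : Finset ℕ) ∅ (fun _ => 0) (by simp)
    exact h.trans (by simpa using Finset.sum_nonneg fun k _ => hG.cap_nonneg (S k))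
  have : Nonempty ι := ⟨(hex x₀ hx₀).choose⟩
  choose! κ hκI hκS using hex
  refine (hG.capFinset_le_sum I K κ hκI).trans (Finset.sum_le_sum fun k hk => ?_)
  refine le_ciSup (hS k hk) ⟨K.filter fun x => κ x = k, fun x hx => ?_⟩
  obtain ⟨hxK, rfl⟩ := Finset.mem_filter.1 hx
  exact hκS x hxK

/-! ### Averages of probability weights -/

/-- The average of probability weights with energies at most `e` and interaction between
different indices at most `s` in total has energy at most `(e + s) / |I|`. -/
theorem isProbOn_average_and_energy_le {ι : Type*} [DecidableEq ι] {I : Finset ι} (hI : I.Nonempty)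
    {K : ι → Finset M.V} {μ : ι → M.V → ℝ} (hμ : ∀ k ∈ I, M.IsProbOn (K k) (μ k))
    {e s : ℝ} {b : ι → ι → ℝ} (he : ∀ k ∈ I, M.energy (K k) (μ k) ≤ e)
    (hb : ∀ k ∈ I, ∀ j ∈ I, k ≠ j → ∀ x ∈ K k, ∀ y ∈ K j, M.green x y ≤ b k j)
    (hs : ∀ k ∈ I, ∑ j ∈ I.erase k, b k j ≤ s) :
    M.IsProbOn (I.biUnion K) (fun x => (∑ k ∈ I, μ k x) / I.card) ∧
      M.energy (I.biUnion K) (fun x => (∑ k ∈ I, μ k x) / I.card) ≤ (e + s) / I.card := by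
  have hN : (0:ℝ) < I.card := by exact_mod_cast hI.card_pos
  set U := I.biUnion K with hU
  have hsub : ∀ k ∈ I, K k ⊆ U := fun k hk => Finset.subset_biUnion_of_mem K hk
  have hmass : ∀ k ∈ I, ∑ x ∈ U, μ k x = 1 := fun k hk => by
    rw [← Finset.sum_subset (hsub k hk) fun x _ hx => (hμ k hk).2.1 x hx, (hμ k hk).2.2]
  refine ⟨⟨fun x => div_nonneg (Finset.sum_nonneg fun k hk => (hμ k hk).1 x) hN.le,
    fun x hx => ?_, ?_⟩, ?_⟩
  · simp only [Finset.sum_eq_zero fun k hk => (hμ k hk).2.1 x fun h => hx (hsub k hk h), zero_div]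
  · rw [← Finset.sum_div, Finset.sum_comm, Finset.sum_congr rfl hmass, Finset.sum_const,
      nsmul_one, div_self hN.ne']
  · let B : ι → ι → ℝ := fun k j => ∑ x ∈ U, ∑ y ∈ U, μ k x * M.green x y * μ j y
    have hself : ∀ k ∈ I, B k k ≤ e := fun k hk => by
      refine le_of_eq_of_le ?_ (he k hk)
      symm
      have h0 := (hμ k hk).2.1
      rw [energy, Finset.sum_subset (hsub k hk) fun x _ hx => by simp [h0 x hx]]
      refine Finset.sum_congr rfl fun x _ => ?_
      rw [Finset.sum_subset (hsub k hk) fun y _ hy => by simp [h0 y hy]]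
    have hcross : ∀ k ∈ I, ∀ j ∈ I, k ≠ j → B k j ≤ b k j := fun k hk j hj hkj => by
      have hle : B k j ≤ ∑ x ∈ U, ∑ y ∈ U, b k j * (μ k x * μ j y) := by
        refine Finset.sum_le_sum fun x _ => Finset.sum_le_sum fun y _ => ?_
        by_cases hx : x ∈ K k
        · by_cases hy : y ∈ K j
          · have := mul_le_mul_of_nonneg_right (hb k hk j hj hkj x hx y hy)
              (mul_nonneg ((hμ k hk).1 x) ((hμ j hj).1 y))
            linarith
          · simp [(hμ j hj).2.1 y hy]
        · simp [(hμ k hk).2.1 x hx]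
      simpa only [← Finset.mul_sum, hmass k hk, hmass j hj, mul_one] using hle
    have hexpand : M.energy U (fun x => (∑ k ∈ I, μ k x) / I.card) =
        (∑ k ∈ I, ∑ j ∈ I, B k j) / (I.card : ℝ) ^ 2 := by
      have h1 : ∀ x y, (∑ k ∈ I, μ k x) / I.card * M.green x y *
          ((∑ k ∈ I, μ k y) / I.card) =
          (∑ k ∈ I, ∑ j ∈ I, μ k x * M.green x y * μ j y) / (I.card : ℝ) ^ 2 := by
        intro x y
        simp only [← Finset.mul_sum, ← Finset.sum_mul]
        field_simp
      simp only [energy, h1, ← Finset.sum_div, B]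
      congr 1
      simp_rw [Finset.sum_comm (s := U) (t := I)]
    have hrow : ∀ k ∈ I, ∑ j ∈ I, B k j ≤ e + s := fun k hk => by
      rw [← Finset.add_sum_erase I _ hk]
      refine add_le_add (hself k hk) ((Finset.sum_le_sum fun j hj => ?_).trans (hs k hk))
      obtain ⟨hjk, hj⟩ := Finset.mem_erase.1 hj
      exact hcross k hk j hj hjk.symm
    have htotal : ∑ k ∈ I, ∑ j ∈ I, B k j ≤ I.card * (e + s) := by
      simpa only [Finset.sum_const, nsmul_eq_mul] using Finset.sum_le_sum hrow
    rw [hexpand, div_le_div_iff₀ (by positivity) hN]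
    nlinarith

end WGraph

/-- **Lemma 4.2 (near-additive lower bound on the capacity of a union of
well-separated sets).** -/
theorem cap_union_lower_bound (M : WGraph) (hS : M.Standing)
    (hν1 : 1 ≤ M.ν) (hνα : M.ν ≤ M.α / 2) :
    ∃ c > (0:ℝ), ∀ (ℓ L : ℕ), 2 ≤ ℓ → 2 ≤ L →
      ∀ A : ℕ → Set M.V,
        (∀ k k', k ∈ Finset.Icc 1 ℓ → k' ∈ Finset.Icc 1 ℓ →
          ∀ v ∈ A k, ∀ w ∈ A k', |(k:ℝ) - (k':ℝ)| * L ≤ M.d v w) →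
        ∀ I : Finset ℕ, I ⊆ Finset.Icc 1 ℓ →
        ∀ S : ℕ → Set M.V, (∀ k ∈ I, S k ⊆ A k) →
          c * I.card *
            min ((L:ℝ) ^ M.ν * Real.log (1 + (I.card : ℝ)) ^ (-(bOne M.ν)))
              (sInf ((fun k => M.cap (S k)) '' (I : Set ℕ))) ≤
            M.cap (⋃ k ∈ I, S k) := by
  obtain ⟨c₁, hc₁, C₁, hC₁, -, hoff⟩ := hS.2.2
  obtain ⟨H, hH, hsum⟩ := exists_sum_rpow_neg_le_log hν1
  have hG : M.GreenDecay := hS.2.2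
  refine ⟨(2 + C₁ * H)⁻¹, by positivity, fun ℓ L _ hL A hA I hI S hSA => ?_⟩
  set T := min ((L:ℝ) ^ M.ν * Real.log (1 + (I.card : ℝ)) ^ (-(bOne M.ν)))
    (sInf ((fun k => M.cap (S k)) '' (I : Set ℕ))) with hT
  rcases le_or_gt T 0 with hT0 | hT0
  · exact (mul_nonpos_of_nonneg_of_nonpos (by positivity) hT0).trans (hG.cap_nonneg _)
  rcases I.eq_empty_or_nonempty with hI0 | hI0
  · simpa [hI0] using hG.cap_nonneg ∅
  have hN : 1 ≤ I.card := hI0.card_pos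
  have hNR : (1:ℝ) ≤ I.card := by exact_mod_cast hN
  have hLpos : (0:ℝ) < L := by exact_mod_cast (by omega : 0 < L)
  have hTcap : ∀ k ∈ I, T ≤ M.cap (S k) := fun k hk =>
    (min_le_right _ _).trans (csInf_le (I.finite_toSet.image _).bddBelow ⟨k, hk, rfl⟩)
  have hbdd : ∀ k ∈ I, BddAbove (Set.range fun K : {K : Finset M.V // ↑K ⊆ S k} =>
      M.capFinset K.1) := fun k hk => by
    by_contra hn
    have h0 : M.cap (S k) = 0 := Real.iSup_of_not_bddAbove hn
    exact absurd (hTcap k hk) (by rw [h0]; exact not_le.2 hT0)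
  have hchoose : ∀ k ∈ I, ∃ (K : Finset M.V) (μ : M.V → ℝ), (K : Set M.V) ⊆ S k ∧
      M.IsProbOn K μ ∧ M.energy K μ ≤ 2 / T := fun k hk => by
    have hlt : T / 2 < M.cap (S k) := by linarith [hTcap k hk]
    have : Nonempty {K : Finset M.V // (K : Set M.V) ⊆ S k} := ⟨∅, by simp⟩
    obtain ⟨⟨K, hK⟩, hlt⟩ := exists_lt_of_lt_ciSup hlt
    obtain ⟨μ, hμ, hE⟩ := WGraph.exists_energy_lt_inv (half_pos hT0) hlt
    exact ⟨K, μ, hK, hμ, by rw [inv_div] at hE; exact hE.le⟩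
  choose! K μ hKS hμ hE using hchoose
  have hcross : ∀ k ∈ I, ∀ j ∈ I, k ≠ j → ∀ x ∈ K k, ∀ y ∈ K j,
      M.green x y ≤ C₁ * (L:ℝ) ^ (-M.ν) * |(k:ℝ) - (j:ℝ)| ^ (-M.ν) := by
    intro k hk j hj hkj x hx y hy
    have hd := hA k j (hI hk) (hI hj) x (hSA k hk (hKS k hk hx)) y (hSA j hj (hKS j hj hy))
    have hkj' : 0 < |(k:ℝ) - (j:ℝ)| := abs_pos.2 (sub_ne_zero.2 (by exact_mod_cast hkj))
    have hdpos : 0 < M.d x y := (mul_pos hkj' hLpos).trans_le hd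
    have hxy : x ≠ y := by
      rintro rfl
      exact hdpos.ne' (M.d_self x)
    rw [mul_assoc, mul_comm ((L:ℝ) ^ (-M.ν)), ← Real.mul_rpow hkj'.le hLpos.le]
    exact (hoff x y hxy).2.trans (mul_le_mul_of_nonneg_left
      (Real.rpow_le_rpow_of_nonpos (mul_pos hkj' hLpos) hd (by linarith)) hC₁.le)
  have hlog : 0 < Real.log (1 + (I.card:ℝ)) := Real.log_pos (by linarith)
  have hscale : (L:ℝ) ^ (-M.ν) * Real.log (1 + (I.card:ℝ)) ^ bOne M.ν ≤ T⁻¹ := by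
    have h := inv_anti₀ hT0 (min_le_left _ _ : T ≤ _)
    rwa [mul_inv, Real.rpow_neg hlog.le, inv_inv, ← Real.rpow_neg hLpos.le] at h
  have hrow : ∀ k ∈ I, ∑ j ∈ I.erase k, C₁ * (L:ℝ) ^ (-M.ν) * |(k:ℝ) - (j:ℝ)| ^ (-M.ν) ≤
      C₁ * H / T := fun k _ => by
    have hLν : 0 ≤ C₁ * (L:ℝ) ^ (-M.ν) := by positivity
    calc ∑ j ∈ I.erase k, C₁ * (L:ℝ) ^ (-M.ν) * |(k:ℝ) - (j:ℝ)| ^ (-M.ν)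
        ≤ C₁ * (L:ℝ) ^ (-M.ν) * (H * Real.log (1 + (I.card:ℝ)) ^ bOne M.ν) := by
          rw [← Finset.mul_sum]
          exact mul_le_mul_of_nonneg_left
            ((sum_abs_sub_rpow_neg_le hν1 I k).trans (hsum _ hN)) hLν
      _ = C₁ * H * ((L:ℝ) ^ (-M.ν) * Real.log (1 + (I.card:ℝ)) ^ bOne M.ν) := by ring
      _ ≤ C₁ * H / T := by
          rw [div_eq_mul_inv]
          exact mul_le_mul_of_nonneg_left hscale (by positivity)
  obtain ⟨hprob, henergy⟩ := WGraph.isProbOn_average_and_energy_le hI0 hμ hE hcross hrow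
  have hcap := hG.inv_le_capFinset hprob henergy
  have hunion : (I.biUnion K : Set M.V) ⊆ ⋃ k ∈ I, S k := by
    rw [Finset.coe_biUnion]
    exact Set.iUnion₂_mono hKS
  calc (2 + C₁ * H)⁻¹ * I.card * T = ((2 / T + C₁ * H / T) / I.card)⁻¹ := by
        have : 0 < 2 + C₁ * H := by positivity
        field_simp
    _ ≤ M.capFinset (I.biUnion K) := hcap
    _ ≤ M.cap (⋃ k ∈ I, S k) :=
        le_ciSup (hG.bddAbove_capFinset_iUnion I S hbdd) ⟨I.biUnion K, hunion⟩
end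
end
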